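/- arXiv:1107.1262 — 12 statements merged into one kernel-verified Lean document; each statement's English description precedes it below -/
import Mathlib

section
/- Let R be a commutative Noetherian local ring, E a finite free R-module, and E = E^0 ⊇ E^1 ⊇ ⋯ ⊇ E^m a descending chain of finitely generated R-submodules. Let t_1, …, t_m ∈ R be non-zero-divisors satisfying the persistence condition: for every 1 ≤ i ≤ m one has t_i·E^{i-1} ⊆ E^i, and for every 0 ≤ j < i the map E^i/t_i·E^{i-1} → E^j/t_i·E^j induced by the inclusion E^i ⊆ E^j is injective and its image is a direct summand of the R/(t_i)-module E^j/t_i·E^j which is free as an R/(t_i)-module. Then there exist finite free R-submodules A_0, …, A_m of E such that E = A_0 ⊕ ⋯ ⊕ A_m and, for every 0 ≤ i ≤ m, E^i = A_0 ⊕ ⋯ ⊕ A_{m-i} ⊕ t_i·A_{m-i+1} ⊕ (t_i t_{i-1})·A_{m-i+2} ⊕ ⋯ ⊕ (t_i t_{i-1}⋯t_1)·A_m, i.e. the summand A_{m-i+k} appears with coefficient t_i t_{i-1}⋯t_{i-k+1} for 1 ≤ k ≤ i. -/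
open Pointwise

/-- The map `N/(t•Q) → P/(t•P)` induced by an inclusion `N ≤ P` of submodules,
where `Q ≤ P` (so that `t•Q ≤ t•P`).  Here `N/(t•Q)` denotes the quotient of `N`
by `N ∩ t•Q`, which is `N/(t•Q)` whenever `t•Q ≤ N`. -/
noncomputable def inducedQuotMap {R M : Type*} [CommRing R] [AddCommGroup M] [Module R M]
    (t : R) (N P Q : Submodule R M) (hNP : N ≤ P) (hQP : Q ≤ P) :
    (↥N ⧸ Submodule.comap N.subtype (t • Q)) →ₗ[R]
      (↥P ⧸ Submodule.comap P.subtype (t • P)) :=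
  Submodule.mapQ _ _ (Submodule.inclusion hNP) (by
    intro v hv
    have h1 : t • Q ≤ t • P := Submodule.map_mono hQP
    simp only [Submodule.mem_comap] at hv ⊢
    exact h1 hv)

namespace Submodule

/-- If the induced map `N/(t•Q) → P/(t•P)` is injective with complemented range, then every
element of `N` lying in `I • P` already lies in `I • N + t • Q`. -/
theorem mem_smul_sup_of_inducedQuotMap {R M : Type*} [CommRing R] [AddCommGroup M] [Module R M]
    {t : R} {N P Q : Submodule R M} {hNP : N ≤ P} {hQP : Q ≤ P}
    (hinj : Function.Injective (inducedQuotMap t N P Q hNP hQP))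
    {C : Submodule R (↥P ⧸ Submodule.comap P.subtype (t • P))}
    (hC : IsCompl (LinearMap.range (inducedQuotMap t N P Q hNP hQP)) C)
    (I : Ideal R) {v : M} (hv : v ∈ N) (hvI : v ∈ I • P) : v ∈ I • N ⊔ t • Q := by
  set f := inducedQuotMap t N P Q hNP hQP with hf
  let e := LinearEquiv.ofInjective f hinj
  let g : ↥P →ₗ[R] (↥N ⧸ Submodule.comap N.subtype (t • Q)) :=
    e.symm.toLinearMap ∘ₗ projectionOnto _ C hC ∘ₗ mkQ _
  have hg : g ⟨v, hNP hv⟩ = mkQ _ ⟨v, hv⟩ := by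
    have h1 : mkQ (Submodule.comap P.subtype (t • P)) ⟨v, hNP hv⟩
        = f (mkQ _ ⟨v, hv⟩) := rfl
    have h2 : projectionOnto _ C hC (mkQ (Submodule.comap P.subtype (t • P)) ⟨v, hNP hv⟩)
        = e (mkQ _ ⟨v, hv⟩) := by
      rw [h1]
      exact projectionOnto_apply_of_mem_left hC _
    simp only [g, LinearMap.comp_apply, h2]
    exact e.symm_apply_apply _
  have h1 : (⟨v, hNP hv⟩ : P) ∈ I • (⊤ : Submodule R P) := by
    rw [mem_smul_top_iff]; exact hvI
  have h2 : mkQ (Submodule.comap N.subtype (t • Q)) ⟨v, hv⟩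
      ∈ (I • (⊤ : Submodule R N)).map (mkQ (Submodule.comap N.subtype (t • Q))) := by
    have := mem_map_of_mem (f := g) h1
    rw [hg, map_smul''] at this
    rw [map_smul'', Submodule.map_top, range_mkQ]
    exact (smul_mono_right I le_top : _ ≤ I • (⊤ : Submodule R _)) this
  obtain ⟨w, hw, hwv⟩ := h2
  have h3 : (⟨v, hv⟩ : N) - w ∈ Submodule.comap N.subtype (t • Q) := by
    rw [← Submodule.ker_mkQ (Submodule.comap N.subtype (t • Q)), LinearMap.mem_ker, map_sub,
      hwv, sub_self]
  have hw' : (w : M) ∈ I • N := (mem_smul_top_iff I N w).1 hw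
  have h4 : v - w ∈ t • Q := h3
  have := add_mem_sup hw' h4
  rwa [add_sub_cancel] at this

end Submodule

namespace Module.Basis

variable {R M ι : Type*} [CommRing R] [AddCommGroup M] [Module R M]

/-- A basis vector may be replaced by any vector whose coordinate along it is a unit. -/
theorem exists_update_of_isUnit [DecidableEq ι] (b : Basis ι R M) (x : ι) (v : M)
    (hu : IsUnit (b.repr v x)) :
    ∃ b' : Basis ι R M, b' x = v ∧ (∀ y, y ≠ x → b' y = b y) ∧
      ∀ w, b.repr w x = b'.repr w x * b.repr v x ∧
        ∀ y, y ≠ x → b.repr w y = b'.repr w y + b'.repr w x * b.repr v y := by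
  have h : IsUnit (1 + b.coord x (v - b x)) := by
    simpa [Basis.coord_apply] using hu
  let b' := b.map (LinearEquiv.dilatransvection h)
  have hb'x : b' x = v := by
    simp [b', LinearEquiv.dilatransvection.apply]
  have hb'y : ∀ y, y ≠ x → b' y = b y := by
    intro y hy
    simp [b', LinearEquiv.dilatransvection.apply, hy]
  refine ⟨b', hb'x, hb'y, fun w => ?_⟩
  obtain ⟨u, rfl⟩ := (LinearEquiv.dilatransvection h).surjective w
  have hrepr : b'.repr (LinearEquiv.dilatransvection h u) = b.repr u := by simp [b']
  rw [hrepr, LinearEquiv.dilatransvection.apply]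
  refine ⟨?_, fun y hy => ?_⟩
  · simp; ring
  · simp [hy.symm]

/-- The `i`-th term of the chain `E` is spanned by the vectors `(t (s x) ⋯ t i) • b x`: the
index `s x` records the first step at which the basis vector `b x` gets multiplied. -/
def IsEchelon (b : Basis ι R M) (s : ι → ℕ) (t : ℕ → R) (E : ℕ → Submodule R M) (i : ℕ) : Prop :=
  ∀ v, v ∈ E i ↔ ∀ x, ∏ j ∈ Finset.Icc (s x) i, t j ∣ b.repr v x

theorem IsEchelon.congr {b : Basis ι R M} {s s' : ι → ℕ} {t : ℕ → R} {E : ℕ → Submodule R M}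
    {i : ℕ} (h : b.IsEchelon s t E i) (hs : ∀ x, s x = s' x ∨ i < s x ∧ i < s' x) :
    b.IsEchelon s' t E i := by
  intro v
  rw [h v]
  refine forall_congr' fun x => ?_
  rcases hs x with hx | ⟨hx, hx'⟩
  · rw [hx]
  · rw [Finset.Icc_eq_empty (by omega), Finset.Icc_eq_empty (by omega)]

theorem IsEchelon.of_update {b b' : Basis ι R M} {s : ι → ℕ} {t : ℕ → R}
    {E : ℕ → Submodule R M} {i : ℕ} (h : b.IsEchelon s t E i) {x : ι} {v : M} (hx : i < s x)
    (hv : v ∈ E i)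
    (hb' : ∀ w, ∀ y, y ≠ x → b.repr w y = b'.repr w y + b'.repr w x * b.repr v y) :
    b'.IsEchelon s t E i := by
  intro w
  rw [h w]
  refine forall_congr' fun y => ?_
  by_cases hy : y = x
  · subst hy
    rw [Finset.Icc_eq_empty (by omega)]
    simp
  · rw [hb' w y hy]
    exact dvd_add_left (((h v).1 hv y).mul_left _)

end Module.Basis

section EchelonStep

open Module

variable {R M ι : Type*} [CommRing R] [AddCommGroup M] [Module R M] [Fintype ι]

/-- Elimination: adapt the basis so that the submodule `N` is, modulo the maximal ideal,
concentrated on those basis vectors that belong to it. -/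
theorem exists_eliminated_basis (E : ℕ → Submodule R M) (t : ℕ → R) (n : ℕ) (N : Submodule R M)
    (hN : ∀ i ≤ n, N ≤ E i) (b : Basis ι R M) (s : ι → ℕ)
    (hs1 : ∀ x, 1 ≤ s x) (hs2 : ∀ x, s x ≤ n + 2)
    (hst : ∀ x, s x ≤ n → ¬ IsUnit (t (s x))) (hsN : ∀ x, s x = n + 2 → b x ∈ N)
    (hE : ∀ i ≤ n, b.IsEchelon s t E i) :
    ∃ (b : Basis ι R M) (s : ι → ℕ), (∀ x, 1 ≤ s x) ∧ (∀ x, s x ≤ n + 2) ∧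
      (∀ x, s x ≤ n → ¬ IsUnit (t (s x))) ∧ (∀ x, s x = n + 2 → b x ∈ N) ∧
      (∀ i ≤ n, b.IsEchelon s t E i) ∧
      ∀ v ∈ N, ∀ x, s x ≤ n + 1 → ¬ IsUnit (b.repr v x) := by
  classical
  by_cases hdone : ∀ v ∈ N, ∀ x, s x ≤ n + 1 → ¬ IsUnit (b.repr v x)
  · exact ⟨b, s, hs1, hs2, hst, hsN, hE, hdone⟩
  · push Not at hdone
    obtain ⟨v, hv, x, hx, hu⟩ := hdone
    have hxn : s x = n + 1 := by
      by_contra hne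
      have hle : s x ≤ n := by omega
      have hdvd := ((hE n le_rfl) v).1 (hN n le_rfl hv) x
      exact hst x hle (isUnit_of_dvd_unit
        ((Finset.dvd_prod_of_mem t (Finset.mem_Icc.2 ⟨le_rfl, hle⟩)).trans hdvd) hu)
    obtain ⟨b', hb'x, hb'y, hrep⟩ := b.exists_update_of_isUnit x v hu
    have hlt : (Finset.univ.filter fun y => Function.update s x (n + 2) y ≤ n + 1).card
        < (Finset.univ.filter fun y => s y ≤ n + 1).card := by
      apply Finset.card_lt_card
      rw [Finset.ssubset_iff_of_subset]
      · exact ⟨x, by simp [hx], by simp⟩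
      · intro y
        by_cases hy : y = x
        · subst hy; simp
        · simp [hy]
    refine exists_eliminated_basis E t n N hN b' (Function.update s x (n + 2)) ?_ ?_ ?_ ?_ ?_
    · intro y
      by_cases hy : y = x
      · subst hy; simp
      · simpa [hy] using hs1 y
    · intro y
      by_cases hy : y = x
      · subst hy; simp
      · simpa [hy] using hs2 y
    · intro y
      by_cases hy : y = x
      · subst hy; simp
      · simpa [hy] using hst y
    · intro y
      by_cases hy : y = x
      · subst hy; simpa [hb'x] using hv
      · simpa [hy, hb'y y hy] using hsN y
    · intro i hi
      refine ((hE i hi).of_update (by omega) (hN i hi hv) fun w => (hrep w).2).congr fun y => ?_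
      by_cases hy : y = x
      · subst hy; right; simp; omega
      · simp [hy]
termination_by (Finset.univ.filter fun y => s y ≤ n + 1).card

/-- A submodule `N` between `t (n+1) • E n` and `E n` that is generated modulo `t (n+1) • E n` by
the basis vectors it contains continues an echelon form by one step. -/
theorem Module.Basis.IsEchelon.succ {E : ℕ → Submodule R M} {t : ℕ → R} {n : ℕ} {b : Basis ι R M} {s : ι → ℕ}
    (hs2 : ∀ x, s x ≤ n + 2) (hsN : ∀ x, s x = n + 2 → b x ∈ E (n + 1))
    (hE : b.IsEchelon s t E n) (htE : t (n + 1) • E n ≤ E (n + 1))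
    (hspan : E (n + 1) ≤ Submodule.span R (b '' {x | s x = n + 2}) ⊔ t (n + 1) • E n) :
    b.IsEchelon s t E (n + 1) := by
  classical
  intro v
  constructor
  · intro hv x
    by_cases hx : s x = n + 2
    · rw [hx, Finset.Icc_eq_empty (by omega)]; simp
    · obtain ⟨p, hp, q, hq, rfl⟩ := Submodule.mem_sup.1 (hspan hv)
      obtain ⟨e, he, rfl⟩ := (Submodule.mem_smul_pointwise_iff_exists _ _ _).1 hq
      have hpx : b.repr p x = 0 := by
        by_contra h
        exact hx (b.mem_span_image.1 hp (Finsupp.mem_support_iff.2 h))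
      have := hs2 x
      rw [Finset.prod_Icc_succ_top (by omega), mul_comm]
      simpa [hpx] using mul_dvd_mul_left (t (n + 1)) ((hE e).1 he x)
  · intro h
    have := b.sum_repr v
    rw [← this]
    refine Submodule.sum_mem _ fun x _ => ?_
    by_cases hx : s x = n + 2
    · exact Submodule.smul_mem _ _ (hsN x hx)
    · obtain ⟨d, hd⟩ := h x
      have := hs2 x
      rw [Finset.prod_Icc_succ_top (by omega)] at hd
      refine htE ((Submodule.mem_smul_pointwise_iff_exists _ _ _).2
        ⟨((∏ j ∈ Finset.Icc (s x) n, t j) * d) • b x, (hE _).2 fun y => ?_, ?_⟩)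
      · by_cases hy : y = x
        · subst hy; simp
        · simp [hy]
      · rw [hd, smul_smul]; congr 1; ring

variable [IsNoetherianRing R] [IsLocalRing R] [Module.Finite R M]

/-- One step of the construction of an echelon basis. -/
theorem exists_isEchelon_succ {E : ℕ → Submodule R M} {t : ℕ → R} {n : ℕ}
    (hN : ∀ i ≤ n, E (n + 1) ≤ E i) (htE : t (n + 1) • E n ≤ E (n + 1))
    (hmem : ∀ v ∈ E (n + 1), v ∈ IsLocalRing.maximalIdeal R • (⊤ : Submodule R M) →
      v ∈ IsLocalRing.maximalIdeal R • E (n + 1) ⊔ t (n + 1) • E n)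
    {b : Basis ι R M} {s : ι → ℕ}
    (hs1 : ∀ x, 1 ≤ s x) (hs2 : ∀ x, s x ≤ n + 1)
    (hst : ∀ x, s x ≤ n → ¬ IsUnit (t (s x))) (hE : ∀ i ≤ n, b.IsEchelon s t E i) :
    ∃ (b : Basis ι R M) (s : ι → ℕ), (∀ x, 1 ≤ s x) ∧ (∀ x, s x ≤ n + 2) ∧
      (∀ x, s x ≤ n + 1 → ¬ IsUnit (t (s x))) ∧ ∀ i ≤ n + 1, b.IsEchelon s t E i := by
  classical
  by_cases ht : IsUnit (t (n + 1))
  · have heq : E (n + 1) = E n := by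
      refine le_antisymm (hN n le_rfl) fun v hv => ?_
      obtain ⟨u, hu⟩ := ht
      refine htE ((Submodule.mem_smul_pointwise_iff_exists _ _ _).2
        ⟨(↑u⁻¹ : R) • v, Submodule.smul_mem _ _ hv, ?_⟩)
      rw [← hu, smul_smul, Units.mul_inv, one_smul]
    let s' : ι → ℕ := fun x => if s x = n + 1 then n + 2 else s x
    have hE' : ∀ i ≤ n, b.IsEchelon s' t E i := fun i hi => (hE i hi).congr fun x => by
      simp only [s']; split_ifs <;> omega
    refine ⟨b, s', fun x => ?_, fun x => ?_, fun x hx => ?_, fun i hi => ?_⟩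
    · have := hs1 x
      simp only [s']; split_ifs <;> omega
    · have := hs2 x
      simp only [s']; split_ifs <;> omega
    · have h2 := hs2 x
      by_cases h : s x = n + 1
      · simp [s', h] at hx
      · simpa [s', h] using hst x (by omega)
    · rcases Nat.lt_or_ge n i with h | h
      · obtain rfl : i = n + 1 := by omega
        intro v
        rw [heq, hE' n le_rfl v]
        refine forall_congr' fun x => ?_
        by_cases hx : n + 1 < s' x
        · rw [Finset.Icc_eq_empty (by omega), Finset.Icc_eq_empty (by omega)]
        · rw [Finset.prod_Icc_succ_top (by omega), ht.mul_right_dvd]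
      · exact hE' i h
  · obtain ⟨b, s, hs1, hs2, hst, hsN, hE, hdone⟩ := exists_eliminated_basis E t n (E (n + 1)) hN b s
      hs1 (fun x => (hs2 x).trans (by omega)) hst
      (fun x hx => by have := hs2 x; omega) hE
    refine ⟨b, s, hs1, hs2, fun x hx => ?_, fun i hi => ?_⟩
    · rcases Nat.lt_or_ge n (s x) with h | h
      · rwa [show s x = n + 1 by omega]
      · exact hst x h
    · rcases Nat.lt_or_ge n i with h | h
      swap
      · exact hE i h
      obtain rfl : i = n + 1 := by omega
      refine Basis.IsEchelon.succ hs2 hsN (hE n le_rfl) htE ?_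
      refine Submodule.le_of_le_smul_of_le_jacobson_bot (I := IsLocalRing.maximalIdeal R)
        (IsNoetherian.noetherian _) (IsLocalRing.maximalIdeal_le_jacobson _) fun v hv => ?_
      set p : M := ∑ x ∈ Finset.univ.filter (fun x => s x = n + 2), b.repr v x • b x with hp
      have hpN : p ∈ E (n + 1) := Submodule.sum_mem _ fun x hx =>
        Submodule.smul_mem _ _ (hsN x (Finset.mem_filter.1 hx).2)
      have hpS : p ∈ Submodule.span R (b '' {x | s x = n + 2}) := Submodule.sum_mem _ fun x hx =>
        Submodule.smul_mem _ _ (Submodule.subset_span ⟨x, (Finset.mem_filter.1 hx).2, rfl⟩)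
      have hrest : v - p = ∑ x ∈ Finset.univ.filter (fun x => ¬ s x = n + 2),
          b.repr v x • b x := by
        rw [sub_eq_iff_eq_add', hp, Finset.sum_filter_add_sum_filter_not, b.sum_repr]
      have hmax : v - p ∈ IsLocalRing.maximalIdeal R • (⊤ : Submodule R M) := by
        rw [hrest]
        refine Submodule.sum_mem _ fun x hx => Submodule.smul_mem_smul ?_ trivial
        have h1 := (Finset.mem_filter.1 hx).2
        have h2 := hs2 x
        exact (IsLocalRing.mem_maximalIdeal _).2 (hdone v hv x (by omega))
      have hfin := hmem _ (Submodule.sub_mem _ hv hpN) hmax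
      rw [← add_sub_cancel p v, sup_assoc, sup_comm (t (n + 1) • E n)]
      exact Submodule.add_mem_sup hpS hfin

end EchelonStep

/-- The submodules spanned by the fibres of an index function on a basis are independent. -/
theorem Module.Basis.iSupIndep_span_fiber {R M ι κ : Type*} [CommRing R] [AddCommGroup M]
    [Module R M] (b : Basis ι R M) (f : ι → κ) :
    iSupIndep fun k => Submodule.span R (b '' {x | f x = k}) := by
  intro k
  rw [← Submodule.span_iUnion₂, ← Set.image_iUnion₂]
  refine b.linearIndependent.disjoint_span_image (Set.disjoint_left.2 fun x hx hx' => ?_)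
  simp only [Set.mem_iUnion, Set.mem_ofPred_eq] at hx hx'
  obtain ⟨j, hj, hxj⟩ := hx'
  exact hj (hxj ▸ hx)

/-- Existence of an echelon decomposition (normal form) for a
pre-echelon datum over a Noetherian local ring: given a descending chain
`E = E⁰ ⊇ E¹ ⊇ ⋯ ⊇ Eᵐ` of finitely generated submodules of a finite free module
and non-zero-divisors `t₁, …, t_m` satisfying the persistence condition, there are
finite free submodules `A₀, …, A_m` with `E = A₀ ⊕ ⋯ ⊕ A_m` and
`Eⁱ = A₀ ⊕ ⋯ ⊕ A_{m−i} ⊕ t_i·A_{m−i+1} ⊕ ⋯ ⊕ (t_i⋯t₁)·A_m`. -/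
theorem echelon_decomposition_exists
    {R M : Type*} [CommRing R] [IsNoetherianRing R] [IsLocalRing R]
    [AddCommGroup M] [Module R M] [Module.Free R M] [Module.Finite R M]
    (m : ℕ) (hm : 1 ≤ m)
    (Esub : ℕ → Submodule R M)
    (hE0 : Esub 0 = ⊤)
    (hchain : ∀ i, 1 ≤ i → i ≤ m → Esub i ≤ Esub (i - 1))
    (hfg : ∀ i ≤ m, (Esub i).FG)
    (t : ℕ → R) (hreg : ∀ i, 1 ≤ i → i ≤ m → t i ∈ nonZeroDivisors R)
    (hpers1 : ∀ i, 1 ≤ i → i ≤ m → t i • Esub (i - 1) ≤ Esub i)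
    (hpers2 : ∀ i j, 1 ≤ i → i ≤ m → j < i →
      ∀ (hNP : Esub i ≤ Esub j) (hQP : Esub (i - 1) ≤ Esub j),
        Function.Injective (inducedQuotMap (t i) (Esub i) (Esub j) (Esub (i - 1)) hNP hQP) ∧
        (∃ C, IsCompl
          (LinearMap.range (inducedQuotMap (t i) (Esub i) (Esub j) (Esub (i - 1)) hNP hQP)) C) ∧
        ∃ n : ℕ, Nonempty
          (↥(LinearMap.range (inducedQuotMap (t i) (Esub i) (Esub j) (Esub (i - 1)) hNP hQP))
            ≃ₗ[R] (Fin n → R ⧸ Ideal.span {t i}))) :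
    ∃ A : Fin (m + 1) → Submodule R M,
      (∀ k, Module.Free R ↥(A k) ∧ Module.Finite R ↥(A k)) ∧
      iSupIndep A ∧
      (⨆ k, A k) = ⊤ ∧
      ∀ i ≤ m, Esub i
        = ⨆ k : Fin (m + 1), (∏ j ∈ Finset.Icc (m + 1 - (k : ℕ)) i, t j) • A k := by
  classical
  have hanti : ∀ n ≤ m, ∀ i ≤ n, Esub n ≤ Esub i := by
    intro n
    induction n with
    | zero => intro _ i hi; rw [Nat.le_zero.1 hi]
    | succ n ih =>
      intro hn i hi
      rcases Nat.lt_or_ge n i with h | h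
      · rw [show i = n + 1 by omega]
      · exact (hchain (n + 1) (by omega) hn).trans (ih (by omega) i h)
  have key : ∀ n ≤ m, ∃ (b : Module.Basis (Module.Free.ChooseBasisIndex R M) R M)
      (s : Module.Free.ChooseBasisIndex R M → ℕ), (∀ x, 1 ≤ s x) ∧ (∀ x, s x ≤ n + 1) ∧
      (∀ x, s x ≤ n → ¬ IsUnit (t (s x))) ∧ ∀ i ≤ n, b.IsEchelon s t Esub i := by
    intro n
    induction n with
    | zero =>
      refine fun _ => ⟨Module.Free.chooseBasis R M, fun _ => 1, by simp, by simp, by simp, ?_⟩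
      intro i hi v
      rw [Nat.le_zero.1 hi, hE0]
      simp
    | succ n ih =>
      intro hn
      obtain ⟨b, s, hs1, hs2, hst, hE⟩ := ih (by omega)
      refine exists_isEchelon_succ (fun i hi => hanti (n + 1) hn i (by omega))
        (hpers1 (n + 1) (by omega) hn) (fun v hv hv' => ?_) hs1 hs2 hst hE
      obtain ⟨hinj, ⟨C, hC⟩, -⟩ := hpers2 (n + 1) 0 (by omega) hn (by omega)
        (hE0 ▸ le_top) (hE0 ▸ le_top)
      exact Submodule.mem_smul_sup_of_inducedQuotMap hinj hC _ hv (hE0 ▸ hv')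
  obtain ⟨b, s, hs1, hs2, -, hE⟩ := key m le_rfl
  let f : Module.Free.ChooseBasisIndex R M → Fin (m + 1) :=
    fun x => ⟨m + 1 - s x, by have := hs1 x; omega⟩
  have hf : ∀ x, m + 1 - (f x : ℕ) = s x := fun x => by
    have := hs2 x
    simp only [f]; omega
  have hbmem : ∀ x, b x ∈ Submodule.span R (b '' {y | f y = f x}) :=
    fun x => Submodule.subset_span ⟨x, rfl, rfl⟩
  refine ⟨fun k => Submodule.span R (b '' {x | f x = k}), fun k => ?_,
    b.iSupIndep_span_fiber f, ?_, fun i hi => le_antisymm (fun v hv => ?_) (iSup_le fun k => ?_)⟩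
  · beta_reduce
    rw [Set.image_eq_range]
    have := Module.Basis.span (b.linearIndependent.comp (Subtype.val : {x | f x = k} → _)
      Subtype.val_injective)
    exact ⟨Module.Free.of_basis this, inferInstance⟩
  · rw [eq_top_iff, ← b.span_eq, Submodule.span_le]
    rintro _ ⟨x, rfl⟩
    exact Submodule.mem_iSup_of_mem (f x) (hbmem x)
  · rw [← b.sum_repr v]
    refine Submodule.sum_mem _ fun x _ => Submodule.mem_iSup_of_mem (f x) ?_
    obtain ⟨d, hd⟩ := (hE i hi v).1 hv x
    rw [hf, hd, mul_smul]
    exact Submodule.smul_mem_pointwise_smul _ _ _ (Submodule.smul_mem _ _ (hbmem x))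
  · rw [Submodule.smul_span, Submodule.span_le]
    rintro _ ⟨_, ⟨x, rfl, rfl⟩, rfl⟩
    refine (hE i hi _).2 fun y => ?_
    by_cases hy : y = x
    · subst hy; simp [hf]
    · simp [hy]
end

section
/- Define R-submodules M_j of E ⊗_R K and N_j^i (for 0 ≤ j ≤ m and 1 ≤ i ≤ m−j) recursively by: M_0 = E, N_0^i = E^i, M_j = (1/y)·N_{j−1}^1 + M_{j−1} for 1 ≤ j ≤ m, and N_j^i = ((1/t)·N_{j−1}^{i+1}) ∩ M_j for 1 ≤ j and 1 ≤ i ≤ m−j. Then for every 0 ≤ j ≤ m one has M_j = E_j = ⨁_{k=0}^m (1/y^{min(j, m−k)})·A_k. In particular each M_j is a free R-module of the same rank as E, M_0 ⊆ M_1 ⊆ ⋯ ⊆ M_m, and y^m·M_m ⊆ E. -/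
open Pointwise

namespace Submodule

section Lattice

variable {R V ι : Type*} [Ring R] [AddCommGroup V] [Module R V]

/-- Sums of submodules contained in the members of an independent family intersect termwise. -/
theorem iSup_inf_iSup_of_iSupIndep [Finite ι] {B C D : ι → Submodule R V} (hD : iSupIndep D)
    (hB : ∀ k, B k ≤ D k) (hC : ∀ k, C k ≤ D k) :
    (⨆ k, B k) ⊓ (⨆ k, C k) = ⨆ k, B k ⊓ C k := by
  have := Fintype.ofFinite ι
  refine le_antisymm ?_ (le_inf (iSup_mono fun _ => inf_le_left) (iSup_mono fun _ => inf_le_right))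
  rintro v ⟨hvB, hvC⟩
  obtain ⟨f, hf, rfl⟩ := (mem_iSup_iff_exists_finsupp B v).1 hvB
  obtain ⟨g, hg, hgf⟩ := (mem_iSup_iff_exists_finsupp C _).1 hvC
  have hfg : f = g := by
    ext k
    rw [Finsupp.sum_fintype _ _ fun _ => rfl, Finsupp.sum_fintype _ _ fun _ => rfl] at hgf
    refine sub_eq_zero.1 ((iSupIndep_iff_finsetSum_eq_zero_imp_eq_zero D).1 hD Finset.univ
      (fun k => f k - g k) (fun k _ => sub_mem (hB k (hf k)) (hC k (hg k))) ?_ k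
      (Finset.mem_univ k))
    rw [Finset.sum_sub_distrib, hgf, sub_self]
  exact (mem_iSup_iff_exists_finsupp _ _).2 ⟨f, fun k => ⟨hf k, hfg ▸ hg k⟩, rfl⟩

/-- The internal direct sum of an independent finite family is isomorphic to the product. -/
noncomputable def iSupEquivPiOfiSupIndep [Fintype ι] [DecidableEq ι] {B : ι → Submodule R V}
    (hB : iSupIndep B) : ↥(⨆ k, B k) ≃ₗ[R] (∀ k, B k) :=
  (LinearEquiv.ofEq _ _ (iSup_eq_range_dfinsupp_lsum B)).trans <|
    (LinearEquiv.ofInjective _ hB.dfinsupp_lsum_injective).symm.trans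
      DFinsupp.linearEquivFunOnFintype

end Lattice

section Scaling

variable {R K V ι : Type*} [CommRing R] [Field K] [Algebra R K]
  [AddCommGroup V] [Module K V] [Module R V] [IsScalarTower R K V]

theorem algebraMap_mul_smul_le (r : R) (c : K) (A : Submodule R V) :
    (algebraMap R K r * c) • A ≤ c • A := by
  rintro _ ⟨a, ha, rfl⟩
  refine ⟨r • a, A.smul_mem r ha, ?_⟩
  simp [mul_smul, smul_comm r c a]

theorem algebraMap_smul_eq (r : R) (A : Submodule R V) : algebraMap R K r • A = r • A := by
  ext v
  simp [mem_smul_pointwise_iff_exists]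

/-- Scaling a submodule by a nonzero scalar of the fraction field is an isomorphism. -/
noncomputable def equivSMulOfNeZero {c : K} (hc : c ≠ 0) (A : Submodule R V) :
    A ≃ₗ[R] ↥(c • A) :=
  A.equivMapOfInjective (DistribSMul.toLinearMap R V c) (smul_right_injective V hc)

theorem iSupIndep_smul {A : ι → Submodule R V} (hA : iSupIndep A) {c : K} (hc : c ≠ 0) :
    iSupIndep fun k => c • A k := by
  rw [iSupIndep_iff_finsetSum_eq_zero_imp_eq_zero] at hA ⊢
  intro s v hv hsum k hk
  have hmem : ∀ i ∈ s, c⁻¹ • v i ∈ A i := by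
    intro i hi
    obtain ⟨a, ha, hav⟩ := hv i hi
    rw [← hav]
    simpa [inv_smul_smul₀ hc] using ha
  have := hA s (fun i => c⁻¹ • v i) hmem (by rw [← Finset.smul_sum, hsum, smul_zero]) k hk
  simpa [hc] using this

variable [IsFractionRing R K]

/-- The summand in degree `k` of the step producing the next echelon modification. -/
theorem echelon_sup_step {t x y : R} (hy : y ≠ 0) (ht : t = x * y)
    (A : Submodule R V) {m j k : ℕ} (hk : k ≤ m) :
    ((algebraMap R K y)⁻¹ * (algebraMap R K t ^ (1 + k - m) *
        (algebraMap R K y)⁻¹ ^ min j (m - (1 + k)))) • A ⊔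
      ((algebraMap R K y)⁻¹ ^ min j (m - k)) • A =
    ((algebraMap R K y)⁻¹ ^ min (j + 1) (m - k)) • A := by
  have hy' : algebraMap R K y ≠ 0 := by simpa using hy
  rcases hk.eq_or_lt with rfl | hk
  · rw [show 1 + k - k = 1 by omega, show k - (1 + k) = 0 by omega, Nat.sub_self]
    simp only [Nat.min_zero, pow_zero, mul_one, pow_one]
    refine sup_eq_right.2 ?_
    convert algebraMap_mul_smul_le x (1 : K) A using 2
    rw [ht, map_mul]
    field_simp
  · rw [show 1 + k - m = 0 by omega, pow_zero, one_mul, ← pow_succ',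
      show min j (m - (1 + k)) + 1 = min (j + 1) (m - k) by omega]
    refine sup_eq_left.2 ?_
    obtain ⟨n, hn⟩ := Nat.exists_eq_add_of_le
      (show min j (m - k) ≤ min (j + 1) (m - k) by omega)
    rw [hn]
    convert algebraMap_mul_smul_le (y ^ n) ((algebraMap R K y)⁻¹ ^ (min j (m - k) + n)) A using 2
    rw [map_pow, pow_add, inv_pow, inv_pow]
    field_simp

/-- For coprime `x` and `z`, a free submodule satisfies `x⁻¹A ∩ z⁻¹A ⊆ A`. -/
theorem inv_smul_inf_inv_smul_le [DecompositionMonoid R] {x z : R} (hx : x ≠ 0) (hz : z ≠ 0)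
    (hxz : IsRelPrime x z) (A : Submodule R V) [Module.Free R A] :
    (algebraMap R K x)⁻¹ • A ⊓ (algebraMap R K z)⁻¹ • A ≤ A := by
  have hx' : algebraMap R K x ≠ 0 := by simpa using hx
  have hz' : algebraMap R K z ≠ 0 := by simpa using hz
  rintro _ ⟨⟨a, ha, rfl⟩, ⟨b, hb, hab⟩⟩
  simp only [DistribSMul.toLinearMap_apply] at hab ⊢
  have hab' : z • (⟨a, ha⟩ : A) = x • ⟨b, hb⟩ := by
    ext
    change z • a = x • b
    rw [inv_smul_eq_iff₀ hz', smul_comm, eq_inv_smul_iff₀ hx'] at hab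
    simpa using hab.symm
  let e := Module.Free.chooseBasis R A
  have hdvd : ∀ i, ∃ c, e.repr ⟨a, ha⟩ i = x * c := fun i => by
    refine hxz.dvd_of_dvd_mul_left ⟨e.repr ⟨b, hb⟩ i, ?_⟩
    have := DFunLike.congr_fun (congrArg e.repr hab') i
    rwa [map_smul, map_smul] at this
  have hmem : (⟨a, ha⟩ : A) ∈ x • (⊤ : Submodule R A) := by
    rw [← e.linearCombination_repr ⟨a, ha⟩, Finsupp.linearCombination_apply]
    refine sum_mem fun i _ => ?_
    obtain ⟨c, hc⟩ := hdvd i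
    exact ⟨c • e i, mem_top, (mul_smul x c (e i)).symm.trans (congrArg (· • e i) hc.symm)⟩
  obtain ⟨c, -, hc⟩ := hmem
  have hca : x • (c : V) = a := congrArg Subtype.val hc
  rw [← hca, ← algebraMap_smul K x (c : V), inv_smul_smul₀ hx']
  exact c.2

variable [IsDomain R]

/-- Finitely many multiples by fractions are contained in a common multiple. -/
theorem exists_smul_le_smul [Finite ι] (A : ι → Submodule R V) (u : ι → K) :
    ∃ d : K, d ≠ 0 ∧ ∀ k, u k • A k ≤ d • A k := by
  obtain ⟨b, hb⟩ := IsLocalization.exist_integer_multiples_of_finite (nonZeroDivisors R) u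
  have hb0 : algebraMap R K b ≠ 0 := IsFractionRing.to_map_ne_zero_of_mem_nonZeroDivisors b.2
  refine ⟨(algebraMap R K b)⁻¹, inv_ne_zero hb0, fun k => ?_⟩
  obtain ⟨r, hr⟩ := hb k
  have : u k = algebraMap R K r * (algebraMap R K b)⁻¹ := by
    rw [hr, Algebra.smul_def]
    field_simp
  rw [this]
  exact algebraMap_mul_smul_le r _ _

theorem iSup_smul_inf_iSup_smul [Finite ι] {A : ι → Submodule R V} (hA : iSupIndep A)
    (u w : ι → K) :
    (⨆ k, u k • A k) ⊓ (⨆ k, w k • A k) = ⨆ k, u k • A k ⊓ w k • A k := by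
  obtain ⟨d, hd, h⟩ := exists_smul_le_smul (fun k : ι ⊕ ι => A (k.elim id id)) (Sum.elim u w)
  exact iSup_inf_iSup_of_iSupIndep (iSupIndep_smul hA hd) (fun k => h (.inl k))
    fun k => h (.inr k)

theorem iSupIndep_smul_family [Finite ι] {A : ι → Submodule R V} (hA : iSupIndep A)
    (u : ι → K) : iSupIndep fun k => u k • A k := by
  obtain ⟨d, hd, h⟩ := exists_smul_le_smul A u
  exact (iSupIndep_smul hA hd).mono h

/-- Rescaling the summands of a direct sum by nonzero fractions does not change its isomorphism
class. -/
theorem nonempty_iSup_smul_equiv_pi [Fintype ι] [DecidableEq ι] {A : ι → Submodule R V}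
    (hA : iSupIndep A) {u : ι → K} (hu : ∀ k, u k ≠ 0) :
    Nonempty (↥(⨆ k, u k • A k) ≃ₗ[R] (∀ k, A k)) :=
  ⟨(iSupEquivPiOfiSupIndep (iSupIndep_smul_family hA u)).trans
    (LinearEquiv.piCongrRight fun k => (equivSMulOfNeZero (hu k) (A k)).symm)⟩

/-- For coprime `x` and `y`, `x⁻¹y⁻ᵠA ∩ y⁻ᵖA = y⁻ᵠA` whenever `q ≤ p` and `A` is free. -/
theorem inv_mul_pow_smul_inf_pow_smul [DecompositionMonoid R] {x y : R} (hx : x ≠ 0) (hy : y ≠ 0)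
    (hxy : IsRelPrime x y) (A : Submodule R V) [Module.Free R A] {p q : ℕ} (hqp : q ≤ p) :
    ((algebraMap R K x)⁻¹ * (algebraMap R K y)⁻¹ ^ q) • A ⊓ ((algebraMap R K y)⁻¹ ^ p) • A =
      ((algebraMap R K y)⁻¹ ^ q) • A := by
  have hx' : algebraMap R K x ≠ 0 := by simpa using hx
  have hy' : algebraMap R K y ≠ 0 := by simpa using hy
  obtain ⟨n, rfl⟩ := Nat.exists_eq_add_of_le hqp
  refine le_antisymm ?_ (le_inf ?_ ?_)
  · have key := inv_smul_inf_inv_smul_le (K := K) hx (pow_ne_zero n hy) hxy.pow_right A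
    rintro v ⟨⟨a, ha, hav⟩, ⟨b, hb, hbv⟩⟩
    simp only [DistribSMul.toLinearMap_apply] at hav hbv
    have hq := pow_ne_zero q hy'
    refine ⟨algebraMap R K y ^ q • v, key ⟨⟨a, ha, ?_⟩, ⟨b, hb, ?_⟩⟩, ?_⟩
    · simp only [DistribSMul.toLinearMap_apply]
      rw [← hav, smul_smul]
      congr 1
      rw [inv_pow]
      field_simp
    · simp only [DistribSMul.toLinearMap_apply]
      rw [← hbv, smul_smul]
      congr 1
      rw [map_pow, pow_add, inv_pow, inv_pow]
      field_simp
    · simp only [DistribSMul.toLinearMap_apply]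
      rw [inv_pow, inv_smul_smul₀ hq]
  · convert algebraMap_mul_smul_le x ((algebraMap R K x)⁻¹ * (algebraMap R K y)⁻¹ ^ q) A using 2
    field_simp
  · convert algebraMap_mul_smul_le (y ^ n) ((algebraMap R K y)⁻¹ ^ (q + n)) A using 2
    rw [map_pow, pow_add, inv_pow, inv_pow]
    field_simp

/-- The summand in degree `k` of the step producing the next filtered piece. -/
theorem echelon_inf_step [DecompositionMonoid R] {t x y : R} (hx : x ≠ 0) (hy : y ≠ 0)
    (ht : t = x * y) (hxy : IsRelPrime x y) (A : Submodule R V) [Module.Free R A]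
    (m i j k : ℕ) :
    ((algebraMap R K t)⁻¹ * (algebraMap R K t ^ (i + 1 + k - m) *
        (algebraMap R K y)⁻¹ ^ min j (m - (i + 1 + k)))) • A ⊓
      ((algebraMap R K y)⁻¹ ^ min (j + 1) (m - k)) • A =
    (algebraMap R K t ^ (i + k - m) *
      (algebraMap R K y)⁻¹ ^ min (j + 1) (m - (i + k))) • A := by
  have hx' : algebraMap R K x ≠ 0 := by simpa using hx
  have hy' : algebraMap R K y ≠ 0 := by simpa using hy
  have ht' : algebraMap R K t ≠ 0 := by simp [ht, hx, hy]
  by_cases h : m ≤ i + k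
  · rw [show i + 1 + k - m = (i + k - m) + 1 by omega, show m - (i + 1 + k) = 0 by omega,
      show m - (i + k) = 0 by omega]
    simp only [Nat.min_zero, pow_zero, mul_one]
    rw [pow_succ', inv_mul_cancel_left₀ ht']
    refine inf_eq_left.2 ?_
    have hle := algebraMap_mul_smul_le (t ^ (i + k - m) * y ^ min (j + 1) (m - k))
      ((algebraMap R K y)⁻¹ ^ min (j + 1) (m - k)) A
    convert hle using 2
    rw [map_mul, map_pow, map_pow, inv_pow]
    field_simp
  · rw [show i + 1 + k - m = 0 by omega, show i + k - m = 0 by omega,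
      show min (j + 1) (m - (i + k)) = min j (m - (i + 1 + k)) + 1 by omega, pow_zero, one_mul,
      one_mul, ← inv_mul_pow_smul_inf_pow_smul hx hy hxy A
        (show min j (m - (i + 1 + k)) + 1 ≤ min (j + 1) (m - k) by omega)]
    congr 2
    rw [ht, map_mul, pow_succ]
    field_simp

end Scaling

end Submodule

/-- Local scalar form of the recursive construction of the echelon
modification: the recursively defined modules `M_j` coincide with the explicit
direct sums `E_j = ⊕_k (1/y^{min(j, m−k)})·A_k`; in particular each `M_j` is free of
the same rank as `E`, the `M_j` form an increasing chain, and `y^m·M_m ⊆ E`. -/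
theorem echelon_modification_recursion
    {R K V : Type*} [CommRing R] [IsDomain R] [UniqueFactorizationMonoid R]
    [Field K] [Algebra R K] [IsFractionRing R K]
    [AddCommGroup V] [Module K V] [Module R V] [IsScalarTower R K V]
    (m : ℕ) (hm : 1 ≤ m)
    (t x y : R) (hx : x ≠ 0) (hy : y ≠ 0) (ht : t = x * y) (hxy : IsRelPrime x y)
    (A : ℕ → Submodule R V)
    (hAfree : ∀ k ≤ m, Module.Free R ↥(A k))
    (hAfin : ∀ k ≤ m, Module.Finite R ↥(A k))
    (hindep : iSupIndep fun k : Fin (m + 1) => A k)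
    (E : Submodule R V) (hE : E = ⨆ k : Fin (m + 1), A k)
    (Epow : ℕ → Submodule R V)
    (hEpow : ∀ i ≤ m, Epow i = ⨆ k : Fin (m + 1), (t ^ (i + (k : ℕ) - m)) • A k)
    (M : ℕ → Submodule R V) (N : ℕ → ℕ → Submodule R V)
    (hM0 : M 0 = E)
    (hN0 : ∀ i, 1 ≤ i → i ≤ m → N 0 i = Epow i)
    (hMrec : ∀ j, 1 ≤ j → j ≤ m →
      M j = ((algebraMap R K y)⁻¹ • N (j - 1) 1) ⊔ M (j - 1))
    (hNrec : ∀ j i, 1 ≤ j → 1 ≤ i → i ≤ m - j →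
      N j i = ((algebraMap R K t)⁻¹ • N (j - 1) (i + 1)) ⊓ M j) :
    (∀ j ≤ m, M j
      = ⨆ k : Fin (m + 1), ((algebraMap R K y)⁻¹ ^ min j (m - (k : ℕ))) • A k) ∧
    (∀ j ≤ m, Module.Free R ↥(M j) ∧ Module.Finite R ↥(M j) ∧
      Module.finrank R ↥(M j) = Module.finrank R ↥E) ∧
    (∀ j, j < m → M j ≤ M (j + 1)) ∧
    ((algebraMap R K y) ^ m • M m ≤ E) := by
  have hy' : algebraMap R K y ≠ 0 := by simpa using hy
  have hfree (k : Fin (m + 1)) : Module.Free R (A k) := hAfree k (by omega)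
  have hfin (k : Fin (m + 1)) : Module.Finite R (A k) := hAfin k (by omega)
  have main : ∀ j ≤ m,
      (M j = ⨆ k : Fin (m + 1), ((algebraMap R K y)⁻¹ ^ min j (m - (k : ℕ))) • A k) ∧
      ∀ i, 1 ≤ i → i ≤ m - j → N j i = ⨆ k : Fin (m + 1), (algebraMap R K t ^ (i + k - m) *
        (algebraMap R K y)⁻¹ ^ min j (m - (i + (k : ℕ)))) • A k := by
    intro j
    induction j with
    | zero =>
      refine fun _ => ⟨by simp [hM0, hE], fun i hi him => ?_⟩
      rw [hN0 i hi him, hEpow i him]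
      simp [← map_pow, Submodule.algebraMap_smul_eq]
    | succ j ih =>
      intro hj
      obtain ⟨ihM, ihN⟩ := ih (by omega)
      have hMj : M (j + 1) =
          ⨆ k : Fin (m + 1), ((algebraMap R K y)⁻¹ ^ min (j + 1) (m - (k : ℕ))) • A k := by
        rw [hMrec (j + 1) (by omega) hj, Nat.add_sub_cancel, ihN 1 le_rfl (by omega), ihM,
          Submodule.smul_iSup', ← iSup_sup_eq]
        refine iSup_congr fun k => ?_
        rw [smul_smul]
        exact Submodule.echelon_sup_step hy ht (A k) (by omega)
      refine ⟨hMj, fun i hi him => ?_⟩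
      rw [hNrec (j + 1) i (by omega) hi him, Nat.add_sub_cancel, ihN (i + 1) (by omega) (by omega),
        hMj, Submodule.smul_iSup']
      simp_rw [smul_smul]
      rw [Submodule.iSup_smul_inf_iSup_smul hindep]
      exact iSup_congr fun k => Submodule.echelon_inf_step hx hy ht hxy (A k) m i j k
  refine ⟨fun j hj => (main j hj).1, fun j hj => ?_, fun j hj => ?_, ?_⟩
  · obtain ⟨e⟩ := Submodule.nonempty_iSup_smul_equiv_pi hindep
      (u := fun k : Fin (m + 1) => (algebraMap R K y)⁻¹ ^ min j (m - (k : ℕ)))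
      fun k => pow_ne_zero _ (inv_ne_zero hy')
    rw [(main j hj).1, hE]
    exact ⟨.of_equiv e.symm, .equiv e.symm,
      (e.trans (Submodule.iSupEquivPiOfiSupIndep hindep).symm).finrank_eq⟩
  · rw [hMrec (j + 1) (by omega) hj]
    exact le_sup_right
  · rw [(main m le_rfl).1, hE, Submodule.smul_iSup']
    refine iSup_mono fun k => ?_
    rw [smul_smul, min_eq_right (Nat.sub_le m k)]
    have hle := Submodule.algebraMap_mul_smul_le (y ^ (k : ℕ)) (1 : K) (A k)
    rw [one_smul] at hle
    convert hle using 2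
    obtain ⟨n, hn⟩ := Nat.exists_eq_add_of_le (show (k : ℕ) ≤ m by omega)
    rw [show m - (k : ℕ) = n by omega, map_pow]
    nth_rw 1 [hn]
    rw [pow_add, inv_pow]
    field_simp
end

section
/- Set E_m = ⨁_{k=0}^m (1/(y_1 y_2 ⋯ y_{m−k}))·A_k ⊆ E ⊗_R K (empty product equal to 1). Let φ : E → R be an R-linear map such that φ(E^i) ⊆ (y_1 y_2 ⋯ y_i)·R for every 1 ≤ i ≤ m. Then the K-linear extension φ_K : E ⊗_R K → K of φ maps E_m into R; that is, φ extends to an R-linear map E_m → R. -/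
open Pointwise

/-- Local form of the universal property of echelon modifications:
if `φ : E → R` satisfies `φ(Eⁱ) ⊆ (y₁⋯y_i)·R` for all `1 ≤ i ≤ m`, then the `K`-linear
extension of `φ` maps `E_m = ⊕ (1/(y₁⋯y_{m−k}))·A_k` into `R`, i.e. `φ` extends to
an `R`-linear map `E_m → R`. -/
theorem echelon_universal_property_local
    {R K V : Type*} [CommRing R] [IsDomain R] [Field K] [Algebra R K] [IsFractionRing R K]
    [AddCommGroup V] [Module K V] [Module R V] [IsScalarTower R K V]
    (m : ℕ) (hm : 1 ≤ m)
    (t x y : ℕ → R)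
    (htxy : ∀ i ∈ Finset.Icc 1 m, t i ≠ 0 ∧ x i ≠ 0 ∧ y i ≠ 0 ∧ t i = x i * y i)
    (A : ℕ → Submodule R V)
    (hAfree : ∀ k ≤ m, Module.Free R ↥(A k))
    (hAfin : ∀ k ≤ m, Module.Finite R ↥(A k))
    (hindep : iSupIndep fun k : Fin (m + 1) => A k)
    (E : Submodule R V) (hE : E = ⨆ k : Fin (m + 1), A k)
    (hspan : Submodule.span K (E : Set V) = ⊤)
    (Epow : ℕ → Submodule R V)
    (hEpow : ∀ i ≤ m, Epow i
      = ⨆ k : Fin (m + 1), (∏ j ∈ Finset.Icc (m + 1 - (k : ℕ)) i, t j) • A k)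
    (Emod : Submodule R V)
    (hEmod : Emod = ⨆ k : Fin (m + 1),
      (algebraMap R K (∏ j ∈ Finset.Icc 1 (m - (k : ℕ)), y j))⁻¹ • A k)
    (Φ : V →ₗ[K] K)
    (hΦE : ∀ v ∈ E, ∃ r : R, Φ v = algebraMap R K r)
    (hΦpow : ∀ i, 1 ≤ i → i ≤ m → ∀ v ∈ Epow i,
      ∃ r : R, Φ v = algebraMap R K ((∏ j ∈ Finset.Icc 1 i, y j) * r)) :
    ∀ v ∈ Emod, ∃ r : R, Φ v = algebraMap R K r := by
  suffices h : Emod ≤ (LinearMap.range (Algebra.linearMap R K)).comap (Φ.restrictScalars R) by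
    intro v hv
    obtain ⟨r, hr⟩ := h hv
    exact ⟨r, hr.symm⟩
  rw [hEmod]
  refine iSup_le fun k v hv => ?_
  obtain ⟨a, ha, rfl⟩ := (Submodule.mem_smul_pointwise_iff_exists _ _ _).1 hv
  obtain hk | hk := (Nat.lt_succ_iff.1 k.isLt).eq_or_lt
  · obtain ⟨r, hr⟩ := hΦE a (hE ▸ Submodule.mem_iSup_of_mem k ha)
    exact ⟨r, by simp [hk, hr]⟩
  · have haE : a ∈ Epow (m - k) := by
      rw [hEpow _ (Nat.sub_le _ _)]
      refine Submodule.mem_iSup_of_mem k ?_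
      rwa [Finset.Icc_eq_empty (by omega), Finset.prod_empty, one_smul]
    obtain ⟨r, hr⟩ := hΦpow (m - k) (by omega) (Nat.sub_le _ _) a haE
    have hy : algebraMap R K (∏ j ∈ Finset.Icc 1 (m - (k : ℕ)), y j) ≠ 0 := by
      refine (map_ne_zero_iff _ (IsFractionRing.injective R K)).2 (Finset.prod_ne_zero_iff.2 ?_)
      intro j hj
      rw [Finset.mem_Icc] at hj
      exact (htxy j (Finset.mem_Icc.2 ⟨hj.1, by omega⟩)).2.2.1
    refine ⟨r, ?_⟩
    rw [LinearMap.restrictScalars_apply, map_smul, hr, map_mul, smul_eq_mul,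
      inv_mul_cancel_left₀ hy, Algebra.linearMap_apply]
end

section
/- Set E_m = ⨁_{k=0}^m (1/(y_1 y_2 ⋯ y_{m−k}))·A_k ⊆ E ⊗_R K (empty product equal to 1). Let f : R → S be a ring homomorphism to an integral domain S with fraction field K_S such that f(t_i) ≠ 0 and f(y_i) ≠ 0 for all 1 ≤ i ≤ m. Let A_k^S denote the image of S ⊗_R A_k in S ⊗_R E, and define (E_S)_m = ⨁_{k=0}^m (1/(f(y_1) f(y_2) ⋯ f(y_{m−k})))·A_k^S ⊆ (S ⊗_R E) ⊗_S K_S. Then the canonical S-linear map S ⊗_R E_m → (S ⊗_R E) ⊗_S K_S is injective and its image equals (E_S)_m. -/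
open Pointwise TensorProduct

/-- The canonical map `S ⊗_R E_m → (S ⊗_R E) ⊗_S K_S`: an element `v ∈ E_m`
satisfies `Y·v ∈ E` (for `Y = y₁⋯y_m`), and `v` is sent to `(1/f(Y))·(1 ⊗ (Y·v))`. -/
noncomputable def canonicalBaseChangeMap
    {R K V : Type*} [CommRing R] [Field K] [Algebra R K]
    [AddCommGroup V] [Module K V] [Module R V] [IsScalarTower R K V]
    (S KS : Type*) [CommRing S] [Field KS] [Algebra S KS] [Algebra R S]
    (E Emod : Submodule R V) (Y : R)
    (hY : ∀ v ∈ Emod, algebraMap R K Y • v ∈ E) :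
    (S ⊗[R] ↥Emod) →ₗ[S] KS ⊗[S] (S ⊗[R] ↥E) :=
  ((algebraMap S KS (algebraMap R S Y))⁻¹ •
      (TensorProduct.mk S KS (S ⊗[R] ↥E) 1)) ∘ₗ
    (LinearMap.baseChange S (LinearMap.codRestrict E
      (((LinearMap.lsmul K V (algebraMap R K Y)).restrictScalars R) ∘ₗ Emod.subtype)
      (fun v => hY v v.2)))

open Module Submodule

theorem Module.Basis.span_range_coe {R V κ : Type*} [Semiring R] [AddCommMonoid V] [Module R V]
    {A : Submodule R V} (b : Basis κ R A) : span R (Set.range fun j => (b j : V)) = A := by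
  have h := congrArg (map A.subtype) b.span_eq
  rwa [map_span, ← Set.range_comp, map_subtype_top] at h

theorem iSupIndep.linearIndependent_sigma {R V ι : Type*} {κ : ι → Type*} [Ring R]
    [AddCommGroup V] [Module R V] {A : ι → Submodule R V} (hA : iSupIndep A)
    (b : ∀ i, Basis (κ i) R (A i)) :
    LinearIndependent R fun p : Σ i, κ i => (b p.1 p.2 : V) := by
  refine linearIndependent_iUnion_finite (f := fun i j => (b i j : V))
    (fun i => (b i).linearIndependent.map' _ (A i).ker_subtype) fun i s _ hi => ?_
  simp only [(b _).span_range_coe]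
  exact hA.disjoint_biSup hi

theorem LinearIndependent.smul_of_ne_zero {K V ι : Type*} [Field K] [AddCommGroup V] [Module K V]
    {v : ι → V} (hv : LinearIndependent K v) {c : ι → K} (hc : ∀ i, c i ≠ 0) :
    LinearIndependent K fun i => c i • v i :=
  hv.units_smul fun i => Units.mk0 (c i) (hc i)

theorem LinearMap.range_eq_span_range_basis {R M N ι : Type*} [Semiring R] [AddCommMonoid M]
    [AddCommMonoid N] [Module R M] [Module R N] (f : M →ₗ[R] N) (b : Basis ι R M) :
    LinearMap.range f = span R (Set.range fun i => f (b i)) := by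
  rw [LinearMap.range_eq_map, ← b.span_eq, map_span, ← Set.range_comp]
  rfl

theorem Submodule.smul_span_range {R M α ι : Type*} [Semiring R] [AddCommMonoid M] [Module R M]
    [Monoid α] [DistribMulAction α M] [SMulCommClass α R M] (a : α) (v : ι → M) :
    a • span R (Set.range v) = span R (Set.range fun i => a • v i) := by
  rw [smul_span, Set.smul_set_range]

theorem Submodule.iSup_span_range_sigma {R M ι : Type*} {κ : ι → Type*} [Semiring R]
    [AddCommMonoid M] [Module R M] (v : ∀ i, κ i → M) :
    ⨆ i, span R (Set.range (v i)) = span R (Set.range fun p : Σ i, κ i => v p.1 p.2) := by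
  rw [← span_iUnion, Set.range_sigma_eq_iUnion_range]

/-- A basis of `N` from a linearly independent family spanning `N`. -/
noncomputable def Submodule.basisOfSpanEq {R V ι : Type*} [Ring R] [AddCommGroup V] [Module R V]
    {v : ι → V} (hv : LinearIndependent R v) {N : Submodule R V}
    (hN : N = span R (Set.range v)) : Basis ι R N :=
  (Basis.span hv).map (LinearEquiv.ofEq _ _ hN.symm)

@[simp]
theorem Submodule.coe_basisOfSpanEq {R V ι : Type*} [Ring R] [AddCommGroup V] [Module R V]
    {v : ι → V} (hv : LinearIndependent R v) {N : Submodule R V}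
    (hN : N = span R (Set.range v)) (i : ι) : (basisOfSpanEq hv hN i : V) = v i := by
  simp [basisOfSpanEq, Basis.span_apply]

section

variable {R K V : Type*} [CommRing R] [Field K] [Algebra R K]
  [AddCommGroup V] [Module K V] [Module R V] [IsScalarTower R K V]
  (S KS : Type*) [CommRing S] [Field KS] [Algebra S KS] [Algebra R S]

theorem canonicalBaseChangeMap_one_tmul {E Emod : Submodule R V} {Y a c : R}
    (hY : ∀ v ∈ Emod, algebraMap R K Y • v ∈ E) (hYac : Y = a * c)
    (ha : algebraMap R K a ≠ 0) (hc : algebraMap S KS (algebraMap R S c) ≠ 0)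
    {w : Emod} {e : E} (hw : (w : V) = (algebraMap R K a)⁻¹ • (e : V)) :
    canonicalBaseChangeMap S KS E Emod Y hY (1 ⊗ₜ w) =
      (algebraMap S KS (algebraMap R S a))⁻¹ • ((1 : KS) ⊗ₜ[S] ((1 : S) ⊗ₜ[R] e)) := by
  have hcod : (⟨algebraMap R K Y • (w : V), hY w w.2⟩ : E) = c • e := by
    ext
    simp [hw, hYac, smul_smul, mul_right_comm _ _ (_ : K)⁻¹, ha]
  change (algebraMap S KS (algebraMap R S Y))⁻¹ • ((1 : KS) ⊗ₜ[S] ((1 : S) ⊗ₜ[R]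
    (⟨algebraMap R K Y • (w : V), hY w w.2⟩ : E))) = _
  rw [hcod, tmul_smul, ← algebraMap_smul S c ((1 : S) ⊗ₜ[R] e), tmul_smul,
    ← algebraMap_smul KS (algebraMap R S c), smul_smul, hYac, map_mul, map_mul, mul_inv,
    inv_mul_cancel_right₀ hc]

end

/-- Local form of the base-change property of echelon modifications
(`f*Mod_X(χ,E) = Mod_Y(f*χ, f*E)` for dominant `f`): for a ring homomorphism
`R → S` to a domain with `f(t_i) ≠ 0`, `f(y_i) ≠ 0`, the canonical `S`-linear map
`S ⊗_R E_m → (S ⊗_R E) ⊗_S K_S` is injective with image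
`(E_S)_m = ⊕_k (1/(f(y₁)⋯f(y_{m−k})))·A_k^S`. -/
theorem echelon_modification_base_change
    {R K V : Type*} [CommRing R] [IsDomain R] [Field K] [Algebra R K] [IsFractionRing R K]
    [AddCommGroup V] [Module K V] [Module R V] [IsScalarTower R K V]
    (S KS : Type*) [CommRing S] [IsDomain S] [Field KS] [Algebra S KS]
    [IsFractionRing S KS] [Algebra R S]
    (m : ℕ) (hm : 1 ≤ m)
    (t x y : ℕ → R)
    (htxy : ∀ i ∈ Finset.Icc 1 m, t i ≠ 0 ∧ x i ≠ 0 ∧ y i ≠ 0 ∧ t i = x i * y i)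
    (hf : ∀ i ∈ Finset.Icc 1 m, algebraMap R S (t i) ≠ 0 ∧ algebraMap R S (y i) ≠ 0)
    (A : ℕ → Submodule R V)
    (hAfree : ∀ k ≤ m, Module.Free R ↥(A k))
    (hAfin : ∀ k ≤ m, Module.Finite R ↥(A k))
    (hindep : iSupIndep fun k : Fin (m + 1) => A k)
    (E : Submodule R V) (hE : E = ⨆ k : Fin (m + 1), A k)
    (hspan : Submodule.span K (E : Set V) = ⊤)
    (hAE : ∀ k ≤ m, A k ≤ E)
    (Epow : ℕ → Submodule R V)
    (hEpow : ∀ i ≤ m, Epow i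
      = ⨆ k : Fin (m + 1), (∏ j ∈ Finset.Icc (m + 1 - (k : ℕ)) i, t j) • A k)
    (Emod : Submodule R V)
    (hEmod : Emod = ⨆ k : Fin (m + 1),
      (algebraMap R K (∏ j ∈ Finset.Icc 1 (m - (k : ℕ)), y j))⁻¹ • A k)
    (hY : ∀ v ∈ Emod, algebraMap R K (∏ j ∈ Finset.Icc 1 m, y j) • v ∈ E) :
    Function.Injective
      (canonicalBaseChangeMap S KS E Emod (∏ j ∈ Finset.Icc 1 m, y j) hY) ∧
    LinearMap.range (canonicalBaseChangeMap S KS E Emod (∏ j ∈ Finset.Icc 1 m, y j) hY)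
      = ⨆ k : Fin (m + 1),
          (algebraMap S KS (∏ j ∈ Finset.Icc 1 (m - (k : ℕ)), algebraMap R S (y j)))⁻¹ •
            Submodule.map (TensorProduct.mk S KS (S ⊗[R] ↥E) 1)
              (LinearMap.range (LinearMap.baseChange S
                (Submodule.inclusion (hAE k (by omega))))) := by
  classical
  have hfY {n : ℕ} (hn : n ≤ m) :
      algebraMap S KS (algebraMap R S (∏ j ∈ Finset.Icc 1 n, y j)) ≠ 0 := by
    simp only [map_prod, Finset.prod_ne_zero_iff]
    intro i hi
    simpa using (hf i (Finset.Icc_subset_Icc_right hn hi)).2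
  have hRY {n : ℕ} (hn : n ≤ m) : algebraMap R K (∏ j ∈ Finset.Icc 1 n, y j) ≠ 0 := by
    simp only [map_prod, Finset.prod_ne_zero_iff]
    intro i hi
    simpa using (htxy i (Finset.Icc_subset_Icc_right hn hi)).2.2.1
  have hsplit (n : ℕ) (hn : n ≤ m) :
      ∃ c, ∏ j ∈ Finset.Icc 1 m, y j = (∏ j ∈ Finset.Icc 1 n, y j) * c :=
    Finset.prod_dvd_prod_of_subset _ _ _ (Finset.Icc_subset_Icc_right hn)
  have hfree (k : Fin (m + 1)) : Module.Free R (A k) := hAfree k (by omega)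
  let b (k : Fin (m + 1)) := Free.chooseBasis R (A k)
  let a (p : Σ k : Fin (m + 1), Free.ChooseBasisIndex R (A k)) : R :=
    ∏ j ∈ Finset.Icc 1 (m - (p.1 : ℕ)), y j
  have hli := hindep.linearIndependent_sigma b
  have hliK := ((LinearIndependent.iff_fractionRing R K).1 hli).smul_of_ne_zero
    (c := fun p => (algebraMap R K (a p))⁻¹) fun p => inv_ne_zero (hRY (Nat.sub_le _ _))
  have hEspan : E = span R (Set.range fun p : Σ k : Fin (m + 1), Free.ChooseBasisIndex R (A k) =>
      (b p.1 p.2 : V)) := by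
    rw [hE, ← iSup_span_range_sigma fun (k : Fin (m + 1)) j => (b k j : V)]
    simp only [(b _).span_range_coe]
  have hMspan : Emod = span R (Set.range fun p =>
      (algebraMap R K (a p))⁻¹ • (b p.1 p.2 : V)) := by
    rw [hEmod, ← iSup_span_range_sigma fun (k : Fin (m + 1)) j =>
      (algebraMap R K (∏ j ∈ Finset.Icc 1 (m - (k : ℕ)), y j))⁻¹ • (b k j : V)]
    simp only [← smul_span_range, (b _).span_range_coe]
  let bE := basisOfSpanEq hli hEspan
  let bM := (basisOfSpanEq (hliK.restrict_scalars' R) hMspan).baseChange S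
  have hval (p) : canonicalBaseChangeMap S KS E Emod _ hY (bM p) =
      (algebraMap S KS (algebraMap R S (a p)))⁻¹ • ((1 : KS) ⊗ₜ[S] ((1 : S) ⊗ₜ[R] bE p)) := by
    obtain ⟨c, hc⟩ := hsplit (m - p.1) (Nat.sub_le _ _)
    have hcne : algebraMap S KS (algebraMap R S c) ≠ 0 := by
      have h := hfY le_rfl
      rw [hc, map_mul, map_mul] at h
      exact right_ne_zero_of_mul h
    rw [Basis.baseChange_apply]
    exact canonicalBaseChangeMap_one_tmul S KS hY hc (hRY (Nat.sub_le _ _)) hcne (by simp [bE, a])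
  constructor
  · have hliS : LinearIndependent S fun p => canonicalBaseChangeMap S KS E Emod _ hY (bM p) := by
      simp only [hval]
      have h := ((bE.baseChange S).baseChange KS).linearIndependent.smul_of_ne_zero
        (c := fun p => (algebraMap S KS (algebraMap R S (a p)))⁻¹)
        fun p => inv_ne_zero (hfY (Nat.sub_le _ _))
      simpa using h.restrict_scalars' S
    rw [← bM.constr_eq S (f := canonicalBaseChangeMap S KS E Emod _ hY) fun _ => rfl]
    exact bM.injective_constr_of_linearIndependent hliS
  · have hincl (k : Fin (m + 1)) (j) : inclusion (hAE k (by omega)) (b k j) = bE ⟨k, j⟩ := by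
      ext
      simp [bE]
    rw [LinearMap.range_eq_span_range_basis _ bM]
    simp only [hval]
    rw [← iSup_span_range_sigma fun (k : Fin (m + 1)) j =>
      (algebraMap S KS (algebraMap R S (∏ j ∈ Finset.Icc 1 (m - (k : ℕ)), y j)))⁻¹ •
        ((1 : KS) ⊗ₜ[S] ((1 : S) ⊗ₜ[R] bE ⟨k, j⟩))]
    refine iSup_congr fun k => ?_
    rw [← LinearMap.range_comp, LinearMap.range_eq_span_range_basis _ ((b k).baseChange S),
      smul_span_range]
    simp [hincl]
end

section
/- Inside E ⊗_R K the following three R-submodules coincide: (E + (1/y)·E^1) + (1/v)·(F^1 + (1/y)·(E^1 ∩ F^1)) = (E + (1/v)·F^1) + (1/y)·(E^1 + (1/v)·(E^1 ∩ F^1)) = (1/(y v))·A_{00} ⊕ (1/y)·A_{01} ⊕ (1/v)·A_{10} ⊕ A_{11}. In particular, performing the two echelon modifications in either order yields the same free R-submodule of E ⊗_R K. -/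
open Pointwise

theorem iSup_vec_four {α : Type*} [CompleteLattice α] (a b c d : α) :
    iSup ![a, b, c, d] = a ⊔ b ⊔ c ⊔ d := by
  apply le_antisymm
  · refine iSup_le fun i => ?_
    fin_cases i
    · exact le_sup_of_le_left (le_sup_of_le_left le_sup_left)
    · exact le_sup_of_le_left (le_sup_of_le_left le_sup_right)
    · exact le_sup_of_le_left le_sup_right
    · exact le_sup_right
  · refine sup_le (sup_le (sup_le ?_ ?_) ?_) ?_
    · exact le_iSup ![a, b, c, d] 0
    · exact le_iSup ![a, b, c, d] 1
    · exact le_iSup ![a, b, c, d] 2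
    · exact le_iSup ![a, b, c, d] 3

/-- Intersections of sums of subfamilies of an independent family are computed termwise. -/
theorem iSupIndep.iSup_inf_iSup_eq {ι R M : Type*} [Ring R] [AddCommGroup M] [Module R M]
    {A B C : ι → Submodule R M} (hA : iSupIndep A) (hB : B ≤ A) (hC : C ≤ A) :
    iSup B ⊓ iSup C = ⨆ i, B i ⊓ C i := by
  classical
  refine le_antisymm ?_ (le_inf (iSup_mono fun i => inf_le_left) (iSup_mono fun i => inf_le_right))
  rintro m ⟨hmB, hmC⟩
  obtain ⟨f, hf, hfm⟩ := (Submodule.mem_iSup_iff_exists_finsupp B m).1 hmB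
  obtain ⟨g, hg, hgm⟩ := (Submodule.mem_iSup_iff_exists_finsupp C m).1 hmC
  have hsum : ∑ i ∈ f.support ∪ g.support, f i = ∑ i ∈ f.support ∪ g.support, g i := by
    rw [← Finsupp.sum_of_support_subset f Finset.subset_union_left (fun _ a => a) (by simp),
      ← Finsupp.sum_of_support_subset g Finset.subset_union_right (fun _ a => a) (by simp),
      hfm, hgm]
  have heq := (iSupIndep_iff_finsetSum_eq_imp_eq A).1 hA _ f g
    (fun i _ => ⟨hB i (hf i), hC i (hg i)⟩) hsum
  have hfg : ∀ i, f i = g i := by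
    intro i
    by_cases hi : i ∈ f.support ∪ g.support
    · exact heq i hi
    · simp only [Finset.mem_union, Finsupp.mem_support_iff, not_or, not_not] at hi
      rw [hi.1, hi.2]
  exact (Submodule.mem_iSup_iff_exists_finsupp _ m).2
    ⟨f, fun i => ⟨hf i, hfg i ▸ hg i⟩, hfm⟩

theorem iSupIndep.free_iSup {ι R M : Type*} [Ring R] [AddCommGroup M] [Module R M]
    {A : ι → Submodule R M} (hA : iSupIndep A) (hfree : ∀ i, Module.Free R (A i)) :
    Module.Free R ↥(iSup A) := by
  classical
  rw [Submodule.iSup_eq_range_dfinsupp_lsum]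
  exact Module.Free.of_equiv (LinearEquiv.ofInjective _ hA.dfinsupp_lsum_injective)

theorem Submodule.free_pointwise_smul {R S M : Type*} [Ring R] [AddCommGroup M] [Module R M]
    [Monoid S] [DistribMulAction S M] [SMulCommClass S R M] {c : S}
    (hc : Function.Injective (c • · : M → M)) (N : Submodule R M) [Module.Free R N] :
    Module.Free R ↥(c • N) :=
  Module.Free.of_equiv (Submodule.equivMapOfInjective (DistribSMul.toLinearMap R M c) hc N)

/-- In a torsion-free setting, multiples of a free submodule by coprime scalars intersect in the
multiple by the product. -/
theorem Submodule.smul_inf_smul_of_isRelPrime {R M : Type*} [CommRing R] [IsDomain R]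
    [DecompositionMonoid R] [AddCommGroup M] [Module R M] (N : Submodule R M) [Module.Free R N]
    {t s : R} (hts : IsRelPrime t s) :
    t • N ⊓ s • N = (t * s) • N := by
  apply le_antisymm
  · rintro m ⟨hmt, hms⟩
    obtain ⟨a, ha, rfl⟩ := (Submodule.mem_smul_pointwise_iff_exists _ _ _).1 hmt
    obtain ⟨b, hb, hab⟩ := (Submodule.mem_smul_pointwise_iff_exists _ _ _).1 hms
    let e := Module.Free.chooseBasis R N
    have hab' : s • (⟨b, hb⟩ : N) = t • ⟨a, ha⟩ := Subtype.ext hab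
    have hdvd : ∀ i, s ∣ e.repr ⟨a, ha⟩ i := by
      intro i
      have hi := congrArg (fun z => e.repr z i) hab'
      simp only [map_smul, Finsupp.smul_apply, smul_eq_mul] at hi
      exact hts.symm.dvd_of_dvd_mul_left ⟨_, hi.symm⟩
    choose k hk using hdvd
    have hsum : (⟨a, ha⟩ : N) = s • ∑ i ∈ (e.repr ⟨a, ha⟩).support, k i • e i := by
      conv_lhs => rw [← e.linearCombination_repr ⟨a, ha⟩]
      rw [Finsupp.linearCombination_apply, Finsupp.sum, Finset.smul_sum]
      exact Finset.sum_congr rfl fun i _ => by rw [hk i, mul_smul]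
    refine (Submodule.mem_smul_pointwise_iff_exists _ _ _).2
      ⟨_, (∑ i ∈ (e.repr ⟨a, ha⟩).support, k i • e i).2, ?_⟩
    rw [mul_smul]
    exact congrArg (t • ·) (congrArg Subtype.val hsum).symm
  · refine le_inf ?_ ?_
    · rw [mul_smul]
      exact smul_mono_right t (Submodule.smul_le_self_of_tower s N)
    · rw [mul_comm, mul_smul]
      exact smul_mono_right s (Submodule.smul_le_self_of_tower t N)

/-- The intersection of the two first filtration steps of a pair of transverse data. -/
theorem iSupIndep.sup_smul_inf_sup_smul {R M : Type*} [CommRing R] [IsDomain R]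
    [DecompositionMonoid R] [AddCommGroup M] [Module R M] {A00 A01 A10 A11 : Submodule R M}
    [Module.Free R A11] (hA : iSupIndep ![A00, A01, A10, A11]) {t s : R} (hts : IsRelPrime t s) :
    (A00 ⊔ A01 ⊔ t • (A10 ⊔ A11)) ⊓ (A00 ⊔ A10 ⊔ s • (A01 ⊔ A11)) =
      A00 ⊔ s • A01 ⊔ t • A10 ⊔ (t * s) • A11 := by
  have hle (r : R) (N : Submodule R M) : r • N ≤ N := Submodule.smul_le_self_of_tower r N
  have hB : ![A00, A01, t • A10, t • A11] ≤ ![A00, A01, A10, A11] := by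
    intro i
    fin_cases i
    exacts [le_rfl, le_rfl, hle t A10, hle t A11]
  have hC : ![A00, s • A01, A10, s • A11] ≤ ![A00, A01, A10, A11] := by
    intro i
    fin_cases i
    exacts [le_rfl, hle s A01, le_rfl, hle s A11]
  have hinf : (fun i => ![A00, A01, t • A10, t • A11] i ⊓ ![A00, s • A01, A10, s • A11] i) =
      ![A00, s • A01, t • A10, (t * s) • A11] := by
    funext i
    fin_cases i
    exacts [inf_idem A00, inf_eq_right.2 (hle s A01), inf_eq_left.2 (hle t A10),
      A11.smul_inf_smul_of_isRelPrime hts]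
  have h := hA.iSup_inf_iSup_eq hB hC
  rw [hinf, iSup_vec_four, iSup_vec_four, iSup_vec_four] at h
  rw [← h, Submodule.smul_sup', Submodule.smul_sup']
  congr 1
  · ac_rfl
  · ac_rfl

section FractionField

variable {R K V : Type*} [CommRing R] [Field K] [Algebra R K] [AddCommGroup V] [Module K V]
  [Module R V] [IsScalarTower R K V]

theorem Submodule.algebraMap_mul_smul_le_s4 (r : R) (c : K) (N : Submodule R V) :
    (algebraMap R K r * c) • N ≤ c • N := by
  rw [mul_comm, mul_smul]
  refine smul_mono_right c ?_
  rintro _ ⟨n, hn, rfl⟩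
  simpa using N.smul_mem r hn

theorem Submodule.algebraMap_pointwise_smul (r : R) (N : Submodule R V) :
    r • N = algebraMap R K r • N := by
  ext m
  simp [Submodule.mem_smul_pointwise_iff_exists]

theorem echelon_modification_eq (A00 A01 A10 A11 : Submodule R V) (x u : R) {y v : R}
    (hy : algebraMap R K y ≠ 0) (hv : algebraMap R K v ≠ 0) :
    ((A00 ⊔ A01 ⊔ A10 ⊔ A11) ⊔ (algebraMap R K y)⁻¹ • (A00 ⊔ A01 ⊔ (x * y) • (A10 ⊔ A11)))
        ⊔ (algebraMap R K v)⁻¹ • ((A00 ⊔ A10 ⊔ (u * v) • (A01 ⊔ A11)) ⊔ (algebraMap R K y)⁻¹ •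
          (A00 ⊔ (u * v) • A01 ⊔ (x * y) • A10 ⊔ (x * y * (u * v)) • A11))
      = ((algebraMap R K y)⁻¹ * (algebraMap R K v)⁻¹) • A00
          ⊔ (algebraMap R K y)⁻¹ • A01 ⊔ (algebraMap R K v)⁻¹ • A10 ⊔ A11 := by
  set a := algebraMap R K y with ha
  set b := algebraMap R K v with hb
  have le_of_eq_mul (r : R) {c d : K} {N S : Submodule R V} (h : d • N ≤ S)
      (hc : c = algebraMap R K r * d) : c • N ≤ S :=
    hc ▸ (N.algebraMap_mul_smul_le_s4 r d).trans h
  have le_of_eq_inv (r : R) {d : K} {N S : Submodule R V} (h : d • N ≤ S)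
      (hc : 1 = algebraMap R K r * d) : N ≤ S := by
    simpa using le_of_eq_mul r h hc
  simp only [Submodule.algebraMap_pointwise_smul (K := K), Submodule.smul_sup', smul_smul,
    map_mul, ← ha, ← hb]
  apply le_antisymm
  · generalize hS : (a⁻¹ * b⁻¹) • A00 ⊔ a⁻¹ • A01 ⊔ b⁻¹ • A10 ⊔ A11 = S
    have hle := hS.le
    simp only [sup_le_iff] at hle
    obtain ⟨⟨⟨h00, h01⟩, h10⟩, h11⟩ := hle
    rw [← one_smul K A11] at h11
    simp only [sup_le_iff]
    refine ⟨⟨⟨⟨⟨?_, ?_⟩, ?_⟩, ?_⟩, ⟨?_, ?_⟩, ?_, ?_⟩, ⟨⟨?_, ?_⟩, ?_, ?_⟩, ⟨⟨?_, ?_⟩, ?_⟩, ?_⟩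
    · exact le_of_eq_inv (y * v) h00 (by simp only [map_mul, ← ha, ← hb]; field_simp)
    · exact le_of_eq_inv y h01 (by simp only [← ha]; field_simp)
    · exact le_of_eq_inv v h10 (by simp only [← hb]; field_simp)
    · simpa using h11
    · exact le_of_eq_mul v h00 (by simp only [← hb]; field_simp)
    · exact h01
    · exact le_of_eq_mul (x * v) h10 (by simp only [map_mul, ← hb]; field_simp)
    · exact le_of_eq_mul x h11 (by field_simp)
    · exact le_of_eq_mul y h00 (by simp only [← ha]; field_simp)
    · exact h10
    · exact le_of_eq_mul (u * y) h01 (by simp only [map_mul, ← ha]; field_simp)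
    · exact le_of_eq_mul u h11 (by field_simp)
    · exact le_of_eq_mul 1 h00 (by simp only [map_one]; ring)
    · exact le_of_eq_mul u h01 (by field_simp)
    · exact le_of_eq_mul x h10 (by field_simp)
    · exact le_of_eq_mul (x * u) h11 (by simp only [map_mul]; field_simp)
  · generalize hS : (_ : Submodule R V) ⊔ (_ ⊔ _ ⊔ (_ ⊔ _) ⊔ (_ ⊔ _ ⊔ _ ⊔ _)) = S
    have hle := hS.le
    simp only [sup_le_iff] at hle
    obtain ⟨⟨⟨⟨⟨-, -⟩, -⟩, h11⟩, ⟨-, h01⟩, -, -⟩, ⟨⟨-, h10⟩, -, -⟩, ⟨⟨h00, -⟩, -⟩, -⟩ := hle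
    exact sup_le (sup_le (sup_le (mul_comm a⁻¹ b⁻¹ ▸ h00) h01) h10) h11

theorem free_echelon_modification {A00 A01 A10 A11 : Submodule R V}
    (hA : iSupIndep ![A00, A01, A10, A11]) [Module.Free R A00] [Module.Free R A01]
    [Module.Free R A10] [Module.Free R A11] {y v : R}
    (hy : algebraMap R K y ≠ 0) (hv : algebraMap R K v ≠ 0) :
    Module.Free R ↥(((algebraMap R K y)⁻¹ * (algebraMap R K v)⁻¹) • A00
      ⊔ (algebraMap R K y)⁻¹ • A01 ⊔ (algebraMap R K v)⁻¹ • A10 ⊔ A11) := by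
  have hinj {r : R} (hr : algebraMap R K r ≠ 0) : Function.Injective (r • · : V → V) := by
    intro m n hmn
    simp only [← algebraMap_smul K r] at hmn
    exact smul_right_injective V hr hmn
  have hle (r : R) (N : Submodule R V) : r • N ≤ N := Submodule.smul_le_self_of_tower r N
  have hB : ![A00, v • A01, y • A10, (y * v) • A11] ≤ ![A00, A01, A10, A11] := by
    intro i
    fin_cases i
    exacts [le_rfl, hle v A01, hle y A10, hle (y * v) A11]
  have hfree : ∀ i, Module.Free R ↥(![A00, v • A01, y • A10, (y * v) • A11] i) := by
    intro i
    fin_cases i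
    exacts [(inferInstance : Module.Free R A00), A01.free_pointwise_smul (hinj hv),
      A10.free_pointwise_smul (hinj hy),
      A11.free_pointwise_smul (hinj (by simpa only [map_mul] using mul_ne_zero hy hv))]
  have h := (hA.mono hB).free_iSup hfree
  rw [iSup_vec_four] at h
  have hsmul := Submodule.free_pointwise_smul
    (smul_right_injective V (mul_ne_zero (inv_ne_zero hy) (inv_ne_zero hv)))
    (A00 ⊔ v • A01 ⊔ y • A10 ⊔ (y * v) • A11)
  have h01 : (algebraMap R K y)⁻¹ * (algebraMap R K v)⁻¹ * algebraMap R K v =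
      (algebraMap R K y)⁻¹ := by field_simp
  have h10 : (algebraMap R K y)⁻¹ * (algebraMap R K v)⁻¹ * algebraMap R K y =
      (algebraMap R K v)⁻¹ := by field_simp
  have h11 : (algebraMap R K y)⁻¹ * (algebraMap R K v)⁻¹ *
      (algebraMap R K y * algebraMap R K v) = 1 := by field_simp
  have heq : ((algebraMap R K y)⁻¹ * (algebraMap R K v)⁻¹) •
      (A00 ⊔ v • A01 ⊔ y • A10 ⊔ (y * v) • A11) =
      ((algebraMap R K y)⁻¹ * (algebraMap R K v)⁻¹) • A00
        ⊔ (algebraMap R K y)⁻¹ • A01 ⊔ (algebraMap R K v)⁻¹ • A10 ⊔ A11 := by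
    simp only [Submodule.algebraMap_pointwise_smul (K := K), Submodule.smul_sup', smul_smul,
      map_mul, h01, h10, h11, one_smul]
  exact heq ▸ hsmul

end FractionField

/-- Local form, for two transverse echelon data of length one, of the
independence of poly-echelon modification on the ordering: the two iterated
modifications agree and equal `(1/(yv))·A₀₀ ⊕ (1/y)·A₀₁ ⊕ (1/v)·A₁₀ ⊕ A₁₁`. -/
theorem polyechelon_modification_order_independent
    {R K V : Type*} [CommRing R] [IsDomain R] [UniqueFactorizationMonoid R]
    [Field K] [Algebra R K] [IsFractionRing R K]
    [AddCommGroup V] [Module K V] [Module R V] [IsScalarTower R K V]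
    (A00 A01 A10 A11 : Submodule R V)
    (hfree : Module.Free R ↥A00 ∧ Module.Free R ↥A01 ∧ Module.Free R ↥A10 ∧ Module.Free R ↥A11)
    (hfin : Module.Finite R ↥A00 ∧ Module.Finite R ↥A01 ∧ Module.Finite R ↥A10 ∧
      Module.Finite R ↥A11)
    (hindep : iSupIndep ![A00, A01, A10, A11])
    (E : Submodule R V) (hE : E = A00 ⊔ A01 ⊔ A10 ⊔ A11)
    (t s x y u v : R) (hx : x ≠ 0) (hy : y ≠ 0) (hu : u ≠ 0) (hv : v ≠ 0)
    (ht : t = x * y) (hs : s = u * v) (hts : IsRelPrime t s)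
    (E1 F1 : Submodule R V)
    (hE1 : E1 = A00 ⊔ A01 ⊔ t • (A10 ⊔ A11))
    (hF1 : F1 = A00 ⊔ A10 ⊔ s • (A01 ⊔ A11)) :
    ((E ⊔ (algebraMap R K y)⁻¹ • E1)
        ⊔ (algebraMap R K v)⁻¹ • (F1 ⊔ (algebraMap R K y)⁻¹ • (E1 ⊓ F1))
      = (E ⊔ (algebraMap R K v)⁻¹ • F1)
        ⊔ (algebraMap R K y)⁻¹ • (E1 ⊔ (algebraMap R K v)⁻¹ • (E1 ⊓ F1))) ∧
    ((E ⊔ (algebraMap R K y)⁻¹ • E1)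
        ⊔ (algebraMap R K v)⁻¹ • (F1 ⊔ (algebraMap R K y)⁻¹ • (E1 ⊓ F1))
      = ((algebraMap R K y)⁻¹ * (algebraMap R K v)⁻¹) • A00
          ⊔ (algebraMap R K y)⁻¹ • A01 ⊔ (algebraMap R K v)⁻¹ • A10 ⊔ A11) ∧
    Module.Free R ↥((E ⊔ (algebraMap R K y)⁻¹ • E1)
        ⊔ (algebraMap R K v)⁻¹ • (F1 ⊔ (algebraMap R K y)⁻¹ • (E1 ⊓ F1))) := by
  obtain ⟨_, _, _, _⟩ := hfree
  have hinj := IsFractionRing.injective R K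
  have hy' : algebraMap R K y ≠ 0 := (map_ne_zero_iff _ hinj).2 hy
  have hv' : algebraMap R K v ≠ 0 := (map_ne_zero_iff _ hinj).2 hv
  have hinf : E1 ⊓ F1 = A00 ⊔ s • A01 ⊔ t • A10 ⊔ (t * s) • A11 := by
    rw [hE1, hF1]
    exact hindep.sup_smul_inf_sup_smul hts
  have h₁ := echelon_modification_eq A00 A01 A10 A11 x u hy' hv'
  have h₂ := echelon_modification_eq A00 A10 A01 A11 u x hv' hy'
  rw [← ht, ← hs] at h₁ h₂
  rw [mul_comm s t, sup_right_comm A00 A10 A01, sup_right_comm A00 (t • A10),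
    mul_comm (algebraMap R K v)⁻¹, sup_right_comm (_ • A00)] at h₂
  rw [hinf, hE, hE1, hF1, h₁, h₂]
  exact ⟨rfl, rfl, free_echelon_modification hindep hy' hv'⟩
end

section
/- Set E_1 = E + (1/y_1)·E^1 ⊆ E ⊗_R K. Then (1/y_1)·E^1 ⊆ E_1, x_1·E_1 ⊆ (1/y_1)·E^1, and the inclusion E ⊆ E_1 induces an isomorphism of R-modules E/(E^1 + x_1·E) ≅ E_1/((1/y_1)·E^1). In particular, if x_1 is a unit of R then E_1 = (1/y_1)·E^1. -/
open Pointwise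

theorem Submodule.exists_quotient_comap_equiv_of_inf_eq {R V : Type*} [Ring R] [AddCommGroup V]
    [Module R V] (E P Q : Submodule R V) (h : E ⊓ P = E ⊓ Q) :
    ∃ e : (↥E ⧸ Submodule.comap E.subtype Q) ≃ₗ[R]
        (↥(E ⊔ P) ⧸ Submodule.comap (E ⊔ P).subtype P),
      ∀ (w : ↥E) (h : (w : V) ∈ E ⊔ P),
        e (Submodule.Quotient.mk w) = Submodule.Quotient.mk (⟨(w : V), h⟩ : ↥(E ⊔ P)) := by
  have hc : Submodule.comap E.subtype Q = Submodule.comap E.subtype (E ⊓ P) := by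
    rw [h]
    ext w
    simp
  exact ⟨(Submodule.quotEquivOfEq _ _ hc).trans (LinearMap.quotientInfEquivSupQuotient E P),
    fun w _ => rfl⟩

section TwoSummands

variable {R K V : Type*} [CommRing R] [Field K] [Algebra R K] [AddCommGroup V] [Module K V]
  [Module R V] [IsScalarTower R K V]

theorem Submodule.mem_inv_algebraMap_smul {y : R} (hy : algebraMap R K y ≠ 0)
    (N : Submodule R V) {v : V} : v ∈ (algebraMap R K y)⁻¹ • N ↔ y • v ∈ N := by
  rw [Submodule.mem_smul_pointwise_iff_exists]
  constructor
  · rintro ⟨n, hn, rfl⟩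
    rwa [← algebraMap_smul K y, smul_inv_smul₀ hy]
  · intro h
    exact ⟨_, h, by rw [← algebraMap_smul K y v, inv_smul_smul₀ hy]⟩

theorem Submodule.smul_sup_smul_le {x y : R} (hy : algebraMap R K y ≠ 0) (B C : Submodule R V) :
    x • (B ⊔ C ⊔ (algebraMap R K y)⁻¹ • (B ⊔ (x * y) • C)) ≤
      (algebraMap R K y)⁻¹ • (B ⊔ (x * y) • C) := by
  intro u hu
  obtain ⟨v, hv, rfl⟩ := (Submodule.mem_smul_pointwise_iff_exists _ _ _).1 hu
  obtain ⟨w, hw, p, hp, rfl⟩ := Submodule.mem_sup.1 hv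
  rw [smul_add]
  refine add_mem ?_ (Submodule.smul_mem _ _ hp)
  obtain ⟨b, hb, c, hc, rfl⟩ := Submodule.mem_sup.1 hw
  rw [Submodule.mem_inv_algebraMap_smul hy, smul_smul, smul_add, mul_comm y x]
  exact Submodule.add_mem_sup (B.smul_mem _ hb) (Submodule.smul_mem_pointwise_smul _ _ _ hc)

theorem Submodule.sup_inf_inv_smul_eq {x y : R} (hy : algebraMap R K y ≠ 0)
    {B C : Submodule R V} (hBC : Disjoint B C) :
    (B ⊔ C) ⊓ (algebraMap R K y)⁻¹ • (B ⊔ (x * y) • C) =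
      (B ⊔ C) ⊓ (B ⊔ (x * y) • C ⊔ x • (B ⊔ C)) := by
  apply le_antisymm
  · rintro w ⟨hw, hw'⟩
    refine ⟨hw, ?_⟩
    obtain ⟨b, hb, c, hc, rfl⟩ := Submodule.mem_sup.1 hw
    have hw'' := (Submodule.mem_inv_algebraMap_smul hy _).1 hw'
    obtain ⟨b', hb', d, hd, h⟩ := Submodule.mem_sup.1 hw''
    obtain ⟨c', hc', rfl⟩ := (Submodule.mem_smul_pointwise_iff_exists _ _ _).1 hd
    have hyb : y • b - b' = (x * y) • c' - y • c := by
      rw [sub_eq_sub_iff_add_eq_add, ← smul_add, ← h, add_comm]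
    have hzero : (x * y) • c' - y • c = 0 := by
      refine Submodule.disjoint_def.1 hBC _ ?_
        (sub_mem (C.smul_mem _ hc') (C.smul_mem _ hc))
      rw [← hyb]
      exact sub_mem (B.smul_mem _ hb) hb'
    have hcx : c = x • c' := by
      rw [mul_comm, mul_smul, sub_eq_zero, ← algebraMap_smul K y, ← algebraMap_smul K y] at hzero
      exact (smul_right_injective V hy hzero).symm
    subst hcx
    exact Submodule.add_mem_sup (Submodule.mem_sup_left hb)
      (Submodule.smul_mem_pointwise_smul _ _ _ (Submodule.mem_sup_right hc'))
  · refine inf_le_inf le_rfl (sup_le ?_ ?_)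
    · intro w hw
      rw [Submodule.mem_inv_algebraMap_smul hy]
      exact Submodule.smul_mem _ _ hw
    · exact le_trans (smul_mono_right x le_sup_left) (Submodule.smul_sup_smul_le hy B C)

end TwoSummands

theorem Submodule.le_of_isUnit_of_smul_le {R V : Type*} [CommRing R] [AddCommGroup V]
    [Module R V] {x : R} (hx : IsUnit x) {M N : Submodule R V} (h : x • M ≤ N) : M ≤ N := by
  intro v hv
  obtain ⟨u, rfl⟩ := hx
  have := N.smul_mem (↑u⁻¹ : R) (h (Submodule.smul_mem_pointwise_smul _ _ _ hv))
  simpa [smul_smul] using this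

theorem iSup_smul_prod_Icc_one_eq {R V : Type*} [CommRing R] [AddCommGroup V] [Module R V]
    {m : ℕ} (t : ℕ → R) (A : ℕ → Submodule R V) :
    ⨆ k : Fin (m + 1), (∏ j ∈ Finset.Icc (m + 1 - (k : ℕ)) 1, t j) • A k =
      (⨆ k : Fin (m + 1), ⨆ _ : k ≠ Fin.last m, A k) ⊔ t 1 • A m := by
  rw [iSup_split_single _ (Fin.last m), sup_comm]
  congr 1
  · refine iSup_congr fun k => iSup_congr fun hk => ?_
    have hlt : (k : ℕ) < m := Fin.val_lt_last hk
    rw [Finset.Icc_eq_empty (by omega), Finset.prod_empty, one_smul]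
  · simp

/-- Local form of the exact sequence
`0 → E¹(D₁) → E₁ → G¹ ⊗ O_{D₁†} → 0`: for `E₁ = E + (1/y₁)·E¹` one has
`(1/y₁)·E¹ ⊆ E₁`, `x₁·E₁ ⊆ (1/y₁)·E¹`, and the inclusion `E ⊆ E₁` induces an
isomorphism `E/(E¹ + x₁·E) ≅ E₁/((1/y₁)·E¹)`; in particular `E₁ = (1/y₁)·E¹`
when `x₁` is a unit. -/
theorem echelon_first_modification_sequence_I
    {R K V : Type*} [CommRing R] [IsDomain R] [Field K] [Algebra R K] [IsFractionRing R K]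
    [AddCommGroup V] [Module K V] [Module R V] [IsScalarTower R K V]
    (m : ℕ) (hm : 1 ≤ m)
    (t x y : ℕ → R)
    (htxy : ∀ i ∈ Finset.Icc 1 m, t i ≠ 0 ∧ x i ≠ 0 ∧ y i ≠ 0 ∧ t i = x i * y i)
    (A : ℕ → Submodule R V)
    (hAfree : ∀ k ≤ m, Module.Free R ↥(A k))
    (hAfin : ∀ k ≤ m, Module.Finite R ↥(A k))
    (hindep : iSupIndep fun k : Fin (m + 1) => A k)
    (E : Submodule R V) (hE : E = ⨆ k : Fin (m + 1), A k)
    (Epow : ℕ → Submodule R V)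
    (hEpow : ∀ i ≤ m, Epow i
      = ⨆ k : Fin (m + 1), (∏ j ∈ Finset.Icc (m + 1 - (k : ℕ)) i, t j) • A k)
    (E1 : Submodule R V) (hE1 : E1 = E ⊔ (algebraMap R K (y 1))⁻¹ • Epow 1) :
    ((algebraMap R K (y 1))⁻¹ • Epow 1 ≤ E1) ∧
    (x 1 • E1 ≤ (algebraMap R K (y 1))⁻¹ • Epow 1) ∧
    (∃ e : (↥E ⧸ Submodule.comap E.subtype (Epow 1 ⊔ x 1 • E)) ≃ₗ[R]
        (↥E1 ⧸ Submodule.comap E1.subtype ((algebraMap R K (y 1))⁻¹ • Epow 1)),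
      ∀ (w : ↥E) (h : (w : V) ∈ E1),
        e (Submodule.Quotient.mk w) = Submodule.Quotient.mk (⟨(w : V), h⟩ : ↥E1)) ∧
    (IsUnit (x 1) → E1 = (algebraMap R K (y 1))⁻¹ • Epow 1) := by
  obtain ⟨-, -, hy0, hxy⟩ := htxy 1 (Finset.mem_Icc.2 ⟨le_rfl, hm⟩)
  have hy : algebraMap R K (y 1) ≠ 0 := by
    simpa using hy0
  have hsplit : E = (⨆ k : Fin (m + 1), ⨆ _ : k ≠ Fin.last m, A k) ⊔ A m := by
    rw [hE, iSup_split_single _ (Fin.last m), sup_comm, Fin.val_last]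
  have hpow := (hEpow 1 hm).trans (iSup_smul_prod_Icc_one_eq t A)
  have hdisj : Disjoint (⨆ k : Fin (m + 1), ⨆ _ : k ≠ Fin.last m, A k) (A m) :=
    (hindep (Fin.last m)).symm
  rw [hxy] at hpow
  have hsmul : x 1 • E1 ≤ (algebraMap R K (y 1))⁻¹ • Epow 1 := by
    rw [hE1, hpow, hsplit]
    exact Submodule.smul_sup_smul_le hy _ _
  have hle : (algebraMap R K (y 1))⁻¹ • Epow 1 ≤ E1 := hE1 ▸ le_sup_right
  refine ⟨hle, hsmul, ?_, fun hx => (Submodule.le_of_isUnit_of_smul_le hx hsmul).antisymm hle⟩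
  subst hE1
  apply Submodule.exists_quotient_comap_equiv_of_inf_eq
  rw [hpow, hsplit]
  exact Submodule.sup_inf_inv_smul_eq hy hdisj
end

section
/- Set E_1 = E + (1/y_1)·E^1 ⊆ E ⊗_R K. Then E ⊆ E_1, and multiplication by y_1 induces an isomorphism of R-modules E_1/E ≅ E^1/(E^1 ∩ y_1·E). Moreover E_1/E is annihilated by y_1 and is a free R/(y_1)-module of rank equal to rk A_0 + rk A_1 + ⋯ + rk A_{m−1}. -/
open Pointwise

section ScalarModification

variable {R K V : Type*} [CommRing R] [Field K] [Algebra R K]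
  [AddCommGroup V] [Module K V] [Module R V] [IsScalarTower R K V]

/-- Multiplication by `c⁻¹` as a map from `F` to the quotient of `E + c⁻¹ F` by `E`. -/
noncomputable def invSMulMkQ (E F : Submodule R V) (c : K) :
    ↥F →ₗ[R] ↥(E ⊔ c⁻¹ • F) ⧸ Submodule.comap (E ⊔ c⁻¹ • F).subtype E :=
  (Submodule.comap (E ⊔ c⁻¹ • F).subtype E).mkQ ∘ₗ
    LinearMap.codRestrict (E ⊔ c⁻¹ • F) (DistribSMul.toLinearMap R V c⁻¹ ∘ₗ F.subtype)
      fun v => Submodule.mem_sup_right (Submodule.smul_mem_pointwise_smul _ _ _ v.2)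

lemma invSMulMkQ_apply (E F : Submodule R V) (c : K) (v : ↥F) :
    invSMulMkQ E F c v = Submodule.Quotient.mk ⟨c⁻¹ • (v : V),
      Submodule.mem_sup_right (Submodule.smul_mem_pointwise_smul _ _ _ v.2)⟩ := rfl

lemma invSMulMkQ_eq_zero_iff (E F : Submodule R V) (c : K) (v : ↥F) :
    invSMulMkQ E F c v = 0 ↔ c⁻¹ • (v : V) ∈ E := by
  rw [invSMulMkQ_apply, Submodule.Quotient.mk_eq_zero]
  rfl

lemma invSMulMkQ_surjective (E F : Submodule R V) (c : K) :
    Function.Surjective (invSMulMkQ E F c) := by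
  intro q
  obtain ⟨⟨w, hw⟩, rfl⟩ := Submodule.Quotient.mk_surjective _ q
  obtain ⟨u, hu, z, hz, rfl⟩ := Submodule.mem_sup.1 hw
  obtain ⟨v, hv, rfl⟩ := (Submodule.mem_smul_pointwise_iff_exists _ _ _).1 hz
  refine ⟨⟨v, hv⟩, ?_⟩
  rw [invSMulMkQ_apply, Submodule.Quotient.eq]
  have : c⁻¹ • v - (u + c⁻¹ • v) ∈ E := by
    simpa using E.neg_mem hu
  exact this

lemma inv_algebraMap_smul_mem_iff {a : R} (ha : algebraMap R K a ≠ 0) (E : Submodule R V)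
    (v : V) : (algebraMap R K a)⁻¹ • v ∈ E ↔ v ∈ a • E := by
  rw [Submodule.mem_smul_pointwise_iff_exists]
  constructor
  · intro h
    refine ⟨_, h, ?_⟩
    rw [← algebraMap_smul K a, smul_inv_smul₀ ha]
  · rintro ⟨u, hu, rfl⟩
    rwa [← algebraMap_smul K a u, inv_smul_smul₀ ha]

lemma ker_invSMulMkQ {a : R} (ha : algebraMap R K a ≠ 0) (E F : Submodule R V) :
    LinearMap.ker (invSMulMkQ E F (algebraMap R K a))
      = Submodule.comap F.subtype (F ⊓ a • E) := by
  ext v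
  rw [LinearMap.mem_ker, invSMulMkQ_eq_zero_iff, inv_algebraMap_smul_mem_iff ha]
  simp

/-- Multiplication by `a` induces an isomorphism `(E + a⁻¹ F) / E ≃ F / (F ∩ a E)`. -/
lemma exists_linearEquiv_quotient_inf_smul {a : R} (ha : algebraMap R K a ≠ 0)
    (E F : Submodule R V) :
    ∃ e : (↥(E ⊔ (algebraMap R K a)⁻¹ • F) ⧸
          Submodule.comap (E ⊔ (algebraMap R K a)⁻¹ • F).subtype E) ≃ₗ[R]
        (↥F ⧸ Submodule.comap F.subtype (F ⊓ a • E)),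
      ∀ (w : ↥(E ⊔ (algebraMap R K a)⁻¹ • F)) (h : a • (w : V) ∈ F),
        e (Submodule.Quotient.mk w) = Submodule.Quotient.mk (⟨a • (w : V), h⟩ : ↥F) := by
  refine ⟨((Submodule.quotEquivOfEq _ _ (ker_invSMulMkQ ha E F).symm).trans
    ((invSMulMkQ E F (algebraMap R K a)).quotKerEquivOfSurjective
      (invSMulMkQ_surjective E F _))).symm, fun w h => ?_⟩
  rw [LinearEquiv.symm_apply_eq, LinearEquiv.trans_apply, Submodule.quotEquivOfEq_mk]
  refine Eq.trans ?_ (LinearMap.quotKerEquivOfSurjective_apply_mk _ _ _).symm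
  rw [invSMulMkQ_apply]
  congr 1
  ext
  change (w : V) = (algebraMap R K a)⁻¹ • a • (w : V)
  rw [← algebraMap_smul K a, inv_smul_smul₀ ha]

end ScalarModification

/-- The internal direct sum of finitely many finite free submodules has a basis indexed by
the sum of their ranks. -/
lemma nonempty_basis_iSup_of_iSupIndep {R V : Type*} [CommRing R] [IsDomain R] [AddCommGroup V]
    [Module R V] {n : ℕ} (A : Fin n → Submodule R V) (hA : iSupIndep A)
    [∀ k, Module.Free R ↥(A k)] [∀ k, Module.Finite R ↥(A k)] :
    Nonempty (Module.Basis (Fin (∑ k, Module.finrank R ↥(A k))) R ↥(⨆ k, A k)) := by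
  classical
  let f := DFinsupp.lsum ℕ fun k => (A k).subtype
  have hf : Function.Injective f := hA.dfinsupp_lsum_injective
  have hrange : LinearMap.range f = ⨆ k, A k := (Submodule.iSup_eq_range_dfinsupp_lsum A).symm
  exact ⟨((DFinsupp.basis fun k => Module.finBasis R ↥(A k)).map
    ((LinearEquiv.ofInjective f hf).trans (LinearEquiv.ofEq _ _ hrange))).reindex
      finSigmaFinEquiv⟩

lemma iSup_fin_succ_eq_iSup_castSucc_sup_last {α : Type*} [CompleteLattice α] {n : ℕ}
    (f : Fin (n + 1) → α) : ⨆ k, f k = (⨆ k : Fin n, f k.castSucc) ⊔ f (Fin.last n) := by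
  refine le_antisymm (iSup_le fun k => ?_)
    (sup_le (iSup_le fun k => le_iSup f _) (le_iSup f _))
  induction k using Fin.lastCases with
  | last => exact le_sup_right
  | cast k => exact le_sup_of_le_left (le_iSup (fun k : Fin n => f k.castSucc) k)

/-- If `f : (ι → R) → M` is surjective and its kernel consists of the vectors with all entries
divisible by `a`, then `M ≃ (ι → R ⧸ (a))`. -/
lemma nonempty_linearEquiv_quotient_span {R M : Type*} [CommRing R] [AddCommGroup M] [Module R M]
    {ι : Type*} (a : R) (f : (ι → R) →ₗ[R] M) (hf : Function.Surjective f)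
    (hker : ∀ v, f v = 0 ↔ ∀ i, a ∣ v i) :
    Nonempty (M ≃ₗ[R] (ι → R ⧸ Ideal.span {a})) := by
  let g : (ι → R) →ₗ[R] (ι → R ⧸ Ideal.span {a}) :=
    LinearMap.pi fun i => (Ideal.span {a}).mkQ ∘ₗ LinearMap.proj i
  have hg : Function.Surjective g := fun v => by
    choose w hw using fun i => Submodule.Quotient.mk_surjective _ (v i)
    exact ⟨w, funext hw⟩
  have hfg : LinearMap.ker f = LinearMap.ker g := by
    ext v
    rw [LinearMap.mem_ker, LinearMap.mem_ker, hker, funext_iff]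
    refine forall_congr' fun i => ?_
    rw [← Ideal.mem_span_singleton]
    exact (Submodule.Quotient.mk_eq_zero _).symm
  exact ⟨(f.quotKerEquivOfSurjective hf).symm.trans
    ((Submodule.quotEquivOfEq _ _ hfg).trans (g.quotKerEquivOfSurjective hg))⟩

theorem echelon_first_modification_sequence_II
    {R K V : Type*} [CommRing R] [IsDomain R] [Field K] [Algebra R K] [IsFractionRing R K]
    [AddCommGroup V] [Module K V] [Module R V] [IsScalarTower R K V]
    (m : ℕ) (hm : 1 ≤ m)
    (t x y : ℕ → R)
    (htxy : ∀ i ∈ Finset.Icc 1 m, t i ≠ 0 ∧ x i ≠ 0 ∧ y i ≠ 0 ∧ t i = x i * y i)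
    (A : ℕ → Submodule R V)
    (hAfree : ∀ k ≤ m, Module.Free R ↥(A k))
    (hAfin : ∀ k ≤ m, Module.Finite R ↥(A k))
    (hindep : iSupIndep fun k : Fin (m + 1) => A k)
    (E : Submodule R V) (hE : E = ⨆ k : Fin (m + 1), A k)
    (Epow : ℕ → Submodule R V)
    (hEpow : ∀ i ≤ m, Epow i
      = ⨆ k : Fin (m + 1), (∏ j ∈ Finset.Icc (m + 1 - (k : ℕ)) i, t j) • A k)
    (E1 : Submodule R V) (hE1 : E1 = E ⊔ (algebraMap R K (y 1))⁻¹ • Epow 1) :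
    (E ≤ E1) ∧
    (∃ e : (↥E1 ⧸ Submodule.comap E1.subtype E) ≃ₗ[R]
        (↥(Epow 1) ⧸ Submodule.comap (Epow 1).subtype (Epow 1 ⊓ y 1 • E)),
      ∀ (w : ↥E1) (h : y 1 • (w : V) ∈ Epow 1),
        e (Submodule.Quotient.mk w)
          = Submodule.Quotient.mk (⟨y 1 • (w : V), h⟩ : ↥(Epow 1))) ∧
    (∀ q : ↥E1 ⧸ Submodule.comap E1.subtype E, y 1 • q = 0) ∧
    Nonempty ((↥E1 ⧸ Submodule.comap E1.subtype E) ≃ₗ[R]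
      (Fin (∑ k ∈ Finset.range m, Module.finrank R ↥(A k)) → R ⧸ Ideal.span {y 1})) := by
  obtain ⟨-, -, hy, htxy⟩ := htxy 1 (by simp [hm])
  have hyK : algebraMap R K (y 1) ≠ 0 := by simpa using hy
  have hEsup : E = (⨆ k : Fin m, A k) ⊔ A m :=
    hE.trans (iSup_fin_succ_eq_iSup_castSucc_sup_last fun k : Fin (m + 1) => A k)
  have hFsup : Epow 1 = (⨆ k : Fin m, A k) ⊔ t 1 • A m := by
    rw [hEpow 1 hm, iSup_fin_succ_eq_iSup_castSucc_sup_last]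
    congr 1
    · refine iSup_congr fun k => ?_
      rw [Finset.Icc_eq_empty (by simp; omega)]
      simp
    · simp
  have hdisj : Disjoint (⨆ k : Fin m, A k) (A m) :=
    (hindep (Fin.last m)).symm.mono_left
      (iSup_le fun k => le_iSup₂_of_le k.castSucc (Fin.castSucc_lt_last k).ne le_rfl)
  generalize Epow 1 = F at *
  have hFE : F ≤ E := by
    rw [hEsup, hFsup]
    exact sup_le_sup_left (Submodule.smul_le_self_of_tower _ _) _
  subst hE1
  have hsurj := invSMulMkQ_surjective E F (algebraMap R K (y 1))
  refine ⟨le_sup_left, exists_linearEquiv_quotient_inf_smul hyK E F, fun q => ?_, ?_⟩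
  · obtain ⟨v, rfl⟩ := hsurj q
    rw [← map_smul, invSMulMkQ_eq_zero_iff]
    change (algebraMap R K (y 1))⁻¹ • y 1 • (v : V) ∈ E
    rw [← algebraMap_smul K (y 1), inv_smul_smul₀ hyK]
    exact hFE v.2
  have hfree : ∀ k : Fin m, Module.Free R ↥(A k) := fun k => hAfree k k.2.le
  have hfin : ∀ k : Fin m, Module.Finite R ↥(A k) := fun k => hAfin k k.2.le
  obtain ⟨b⟩ := nonempty_basis_iSup_of_iSupIndep (fun k : Fin m => A k)
    (hindep.comp (Fin.castSucc_injective m))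
  rw [Finset.sum_range]
  generalize hB : (⨆ k : Fin m, A k) = B at *
  have hBF : B ≤ F := hFsup ▸ le_sup_left
  refine nonempty_linearEquiv_quotient_span (y 1)
    (invSMulMkQ E F (algebraMap R K (y 1)) ∘ₗ Submodule.inclusion hBF ∘ₗ
      b.equivFun.symm.toLinearMap) ?_ ?_
  · intro q
    obtain ⟨⟨v, hv⟩, rfl⟩ := hsurj q
    rw [hFsup] at hv
    obtain ⟨u, hu, z, hz, rfl⟩ := Submodule.mem_sup.1 hv
    refine ⟨b.equivFun ⟨u, hu⟩, ?_⟩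
    rw [← sub_eq_zero]
    simp only [LinearMap.comp_apply, LinearEquiv.coe_coe, LinearEquiv.symm_apply_apply]
    rw [← map_sub, invSMulMkQ_eq_zero_iff, inv_algebraMap_smul_mem_iff hyK]
    obtain ⟨c, hc, rfl⟩ := (Submodule.mem_smul_pointwise_iff_exists _ _ _).1 hz
    refine (Submodule.mem_smul_pointwise_iff_exists _ _ _).2 ⟨-(x 1 • c), ?_, ?_⟩
    · exact E.neg_mem (E.smul_mem _ (hEsup ▸ Submodule.mem_sup_right hc))
    · change y 1 • -(x 1 • c) = u - (u + t 1 • c)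
      rw [htxy, smul_neg, smul_smul, mul_comm (y 1)]
      abel
  · intro v
    simp only [LinearMap.comp_apply, LinearEquiv.coe_coe]
    rw [invSMulMkQ_eq_zero_iff, inv_algebraMap_smul_mem_iff hyK,
      Submodule.mem_smul_pointwise_iff_exists]
    change (∃ z ∈ E, y 1 • z = (b.equivFun.symm v : V)) ↔ _
    constructor
    · rintro ⟨z, hz, hzv⟩
      rw [hEsup] at hz
      obtain ⟨u, hu, c, hc, rfl⟩ := Submodule.mem_sup.1 hz
      have hyc : y 1 • c = (b.equivFun.symm v : V) - y 1 • u := by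
        rw [← hzv, smul_add]
        abel
      have hyc0 : y 1 • c = 0 := Submodule.disjoint_def.1 hdisj _
        (hyc ▸ B.sub_mem (b.equivFun.symm v).2 (B.smul_mem _ hu)) ((A m).smul_mem _ hc)
      have huv : y 1 • (⟨u, hu⟩ : ↥B) = b.equivFun.symm v := by
        ext
        rw [← hzv, smul_add, hyc0, add_zero]
        rfl
      intro i
      refine ⟨b.equivFun ⟨u, hu⟩ i, ?_⟩
      rw [← smul_eq_mul, ← Pi.smul_apply, ← map_smul, huv, LinearEquiv.apply_symm_apply]
    · intro h
      choose w hw using h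
      refine ⟨(b.equivFun.symm w : V), hEsup ▸ Submodule.mem_sup_left (b.equivFun.symm w).2, ?_⟩
      rw [← Submodule.coe_smul, ← map_smul]
      congr 2
      ext i
      exact (hw i).symm
end

section
/- For every 1 ≤ i ≤ m one has (1/y^i)·E^i ⊆ E_i and x^i·E_i ⊆ (1/y^i)·E^i inside E ⊗_R K. In particular the natural injection E^i(D_i) → E_i exists and its cokernel is annihilated by x^i. -/
open Pointwise

/-- The pointwise scalar action on submodules commutes with suprema. -/
theorem Submodule.pointwise_smul_iSup {α R V ι : Type*} [Monoid α] [Semiring R]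
    [AddCommMonoid V] [Module R V] [DistribMulAction α V] [SMulCommClass α R V]
    (a : α) (S : ι → Submodule R V) : a • (⨆ k, S k) = ⨆ k, a • S k :=
  Submodule.map_iSup _ S

section

variable {R K V : Type*} [CommRing R] [Field K] [Algebra R K]
  [AddCommGroup V] [Module K V] [Module R V] [IsScalarTower R K V]

theorem inv_pow_smul_mul_pow_smul_le {y : R} (hy : algebraMap R K y ≠ 0) (x : R) (e d : ℕ)
    (N : Submodule R V) :
    ((algebraMap R K y)⁻¹ ^ (e + d)) • ((x * y) ^ e) • N ≤ ((algebraMap R K y)⁻¹ ^ d) • N := by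
  rintro _ ⟨_, ⟨a, ha, rfl⟩, rfl⟩
  refine ⟨x ^ e • a, N.smul_mem _ ha, ?_⟩
  simp only [DistribSMul.toLinearMap_apply, ← algebraMap_smul K (_ : R) (_ : V), smul_smul]
  congr 1
  simp only [map_pow, map_mul, inv_pow, mul_pow, pow_add]
  field_simp

theorem pow_smul_inv_pow_smul_le {y : R} (hy : algebraMap R K y ≠ 0) (x : R) (e d : ℕ)
    (N : Submodule R V) :
    (algebraMap R K (x ^ (e + d))) • ((algebraMap R K y)⁻¹ ^ d) • N ≤
      ((algebraMap R K y)⁻¹ ^ (e + d)) • ((x * y) ^ e) • N := by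
  rintro _ ⟨_, ⟨a, ha, rfl⟩, rfl⟩
  refine ⟨_, ⟨x ^ d • a, N.smul_mem _ ha, rfl⟩, ?_⟩
  simp only [DistribSMul.toLinearMap_apply, ← algebraMap_smul K (_ : R) (_ : V), smul_smul]
  congr 1
  simp only [map_pow, map_mul, inv_pow, mul_pow, pow_add]
  field_simp

end

/-- Local scalar form of the natural inclusion `E^i(D_i) → E_i`:
`(1/yⁱ)·Eⁱ ⊆ E_i` and `xⁱ·E_i ⊆ (1/yⁱ)·Eⁱ`, so the cokernel of the injection is
annihilated by `xⁱ`. -/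
theorem echelon_modification_contains_twist
    {R K V : Type*} [CommRing R] [IsDomain R] [UniqueFactorizationMonoid R]
    [Field K] [Algebra R K] [IsFractionRing R K]
    [AddCommGroup V] [Module K V] [Module R V] [IsScalarTower R K V]
    (m : ℕ) (hm : 1 ≤ m)
    (t x y : R) (hx : x ≠ 0) (hy : y ≠ 0) (ht : t = x * y) (hxy : IsRelPrime x y)
    (A : ℕ → Submodule R V)
    (hAfree : ∀ k ≤ m, Module.Free R ↥(A k))
    (hAfin : ∀ k ≤ m, Module.Finite R ↥(A k))
    (hindep : iSupIndep fun k : Fin (m + 1) => A k)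
    (E : Submodule R V) (hE : E = ⨆ k : Fin (m + 1), A k)
    (Epow : ℕ → Submodule R V)
    (hEpow : ∀ i ≤ m, Epow i = ⨆ k : Fin (m + 1), (t ^ (i + (k : ℕ) - m)) • A k)
    (Emod : ℕ → Submodule R V)
    (hEmod : ∀ j ≤ m, Emod j
      = ⨆ k : Fin (m + 1), ((algebraMap R K y)⁻¹ ^ min j (m - (k : ℕ))) • A k) :
    ∀ i, 1 ≤ i → i ≤ m →
      ((algebraMap R K y)⁻¹ ^ i) • Epow i ≤ Emod i ∧
      (algebraMap R K (x ^ i)) • Emod i ≤ ((algebraMap R K y)⁻¹ ^ i) • Epow i := by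
  intro i _ hi
  have hy' : algebraMap R K y ≠ 0 := by simpa using hy
  have key (k : Fin (m + 1)) : i = (i + (k : ℕ) - m) + min i (m - (k : ℕ)) := by omega
  rw [hEpow i hi, hEmod i hi, ht]
  simp only [Submodule.pointwise_smul_iSup]
  refine ⟨iSup_mono fun k => ?_, iSup_mono fun k => ?_⟩
  · have h := inv_pow_smul_mul_pow_smul_le hy' x (i + (k : ℕ) - m) (min i (m - (k : ℕ))) (A k)
    rwa [← key k] at h
  · have h := pow_smul_inv_pow_smul_le hy' x (i + (k : ℕ) - m) (min i (m - (k : ℕ))) (A k)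
    rwa [← key k] at h
end

section
/- Assume m ≥ 2. Then E_1 ⊆ E_2, the quotient E_2/E_1 is annihilated by y, multiplication by y^2 induces an isomorphism of R-modules E_2/E_1 ≅ (A_0 ⊕ ⋯ ⊕ A_{m−2})/y·(A_0 ⊕ ⋯ ⊕ A_{m−2}), and E_2/E_1 is a free R/(y)-module of rank rk A_0 + ⋯ + rk A_{m−2}. -/
open Pointwise

section

variable {R K V : Type*} [CommRing R] [Field K] [Algebra R K]
  [AddCommGroup V] [Module K V] [Module R V] [IsScalarTower R K V]

/-- If `B` is free of rank `n`, then `B / yB` is free of rank `n` over `R / (y)`. -/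
theorem nonempty_quotient_smul_equiv_pi {M : Type*} [AddCommGroup M] [Module R M]
    (B : Submodule R M) (y : R) {n : ℕ} (b : Module.Basis (Fin n) R B) :
    Nonempty ((B ⧸ Submodule.comap B.subtype (y • B)) ≃ₗ[R]
      (Fin n → R ⧸ Ideal.span {y})) := by
  let g : B →ₗ[R] (Fin n → R ⧸ Ideal.span {y}) :=
    ((Submodule.mkQ (Ideal.span {y})).compLeft (Fin n)).comp b.equivFun.toLinearMap
  have hg : Function.Surjective g := by
    intro v
    choose u hu using fun i => Submodule.mkQ_surjective (Ideal.span {y}) (v i)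
    refine ⟨b.equivFun.symm u, ?_⟩
    ext i
    simp only [g, LinearMap.comp_apply, LinearEquiv.coe_coe, LinearEquiv.apply_symm_apply]
    exact hu i
  have hker : Submodule.comap B.subtype (y • B) = LinearMap.ker g := by
    ext v
    rw [Submodule.mem_comap, LinearMap.mem_ker, Submodule.mem_smul_pointwise_iff_exists]
    constructor
    · rintro ⟨w, hw, hwv⟩
      have hv : v = y • (⟨w, hw⟩ : B) := Subtype.ext hwv.symm
      rw [hv]
      ext i
      simp only [g, LinearMap.comp_apply, LinearEquiv.coe_coe, map_smul]
      exact (Submodule.Quotient.mk_eq_zero _).2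
        (Ideal.mul_mem_right _ _ (Ideal.mem_span_singleton_self y))
    · intro hv
      have hdvd (i : Fin n) : y ∣ b.equivFun v i :=
        Ideal.mem_span_singleton.1 ((Submodule.Quotient.mk_eq_zero _).1 (congrFun hv i))
      choose u hu using hdvd
      refine ⟨b.equivFun.symm u, (b.equivFun.symm u).2, ?_⟩
      have : y • b.equivFun.symm u = v := by
        apply b.equivFun.injective
        rw [map_smul, LinearEquiv.apply_symm_apply]
        ext i
        exact (hu i).symm
      exact congrArg Subtype.val this
  exact ⟨(Submodule.quotEquivOfEq _ _ hker).trans (g.quotKerEquivOfSurjective hg)⟩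

/-- An independent finite family of finite free submodules spans a free submodule whose rank is
the sum of the ranks. -/
theorem nonempty_basis_iSup_range [IsDomain R] {M : Type*} [AddCommGroup M] [Module R M]
    (n : ℕ) (A : ℕ → Submodule R M) (hfree : ∀ k < n, Module.Free R (A k))
    (hfin : ∀ k < n, Module.Finite R (A k)) (hind : iSupIndep fun k : Fin n => A k) :
    Nonempty (Module.Basis (Fin (∑ k ∈ Finset.range n, Module.finrank R (A k))) R
      ↥(⨆ k ∈ Finset.range n, A k)) := by
  have (k : Fin n) : Module.Free R (A k) := hfree k k.2
  have (k : Fin n) : Module.Finite R (A k) := hfin k k.2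
  have hsup : (⨆ k : Fin n, A k) = ⨆ k ∈ Finset.range n, A k := by
    simp only [Finset.mem_range]
    refine le_antisymm (iSup_le fun k => le_iSup₂_of_le (k : ℕ) k.2 le_rfl)
      (iSup₂_le fun k hk => le_iSup_of_le (⟨k, hk⟩ : Fin n) le_rfl)
  let e := (LinearEquiv.ofInjective _ hind.dfinsupp_lsum_injective).trans
    (LinearEquiv.ofEq _ _ ((Submodule.iSup_eq_range_dfinsupp_lsum _).symm.trans hsup))
  have hrank : Module.finrank R (Π₀ k : Fin n, A k) =
      ∑ k ∈ Finset.range n, Module.finrank R (A k) := by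
    rw [← Fin.sum_univ_eq_sum_range (fun k => Module.finrank R (A k))]
    exact Module.finrank_directSum R fun k : Fin n => A k
  exact ⟨(Module.finBasisOfFinrankEq R _ hrank).map e⟩

/-- If `B` meets `y²C` trivially, then multiplication by `y²` identifies
`(y⁻²B + C) / (y⁻¹B + C)` with `B / yB`. -/
theorem exists_quotient_equiv_of_sup (y : R) (hy : algebraMap R K y ≠ 0)
    (B C : Submodule R V) (hBC : ∀ c ∈ C, y ^ 2 • c ∈ B → c = 0) (E1 E2 : Submodule R V)
    (hE1 : E1 = (algebraMap R K y)⁻¹ • B ⊔ C) (hE2 : E2 = (algebraMap R K y)⁻¹ ^ 2 • B ⊔ C) :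
    ∃ e : (E2 ⧸ Submodule.comap E2.subtype E1) ≃ₗ[R]
        (B ⧸ Submodule.comap B.subtype (y • B)),
      ∀ (w : E2) (h : y ^ 2 • (w : V) ∈ B),
        e (Submodule.Quotient.mk w) = Submodule.Quotient.mk (⟨y ^ 2 • (w : V), h⟩ : B) := by
  set a := algebraMap R K y with ha
  have hsmul (v : V) : y • v = a • v := (algebraMap_smul K y v).symm
  have hsmul2 (v : V) : y ^ 2 • v = a ^ 2 • v := by
    rw [ha, ← map_pow, algebraMap_smul]
  have hmem (b : B) : a⁻¹ ^ 2 • (b : V) ∈ E2 := by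
    rw [hE2]
    exact Submodule.mem_sup_left (Submodule.smul_mem_pointwise_smul _ _ _ b.2)
  let i : B →ₗ[R] E2 :=
    { toFun b := ⟨a⁻¹ ^ 2 • (b : V), hmem b⟩
      map_add' b c := Subtype.ext (smul_add _ _ _)
      map_smul' r b := Subtype.ext (smul_comm _ r (b : V)) }
  let f := (Submodule.mkQ (Submodule.comap E2.subtype E1)).comp i
  have hf : Function.Surjective f := by
    intro q
    obtain ⟨w, rfl⟩ := Submodule.Quotient.mk_surjective _ q
    obtain ⟨u, hu, c, hc, huc⟩ := Submodule.mem_sup.1 (hE2.le w.2)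
    obtain ⟨b, hb, rfl⟩ := (Submodule.mem_smul_pointwise_iff_exists _ _ _).1 hu
    refine ⟨⟨b, hb⟩, (Submodule.Quotient.eq _).2 ?_⟩
    change a⁻¹ ^ 2 • b - (w : V) ∈ E1
    rw [← huc, hE1, sub_add_cancel_left]
    exact Submodule.mem_sup_right (neg_mem hc)
  have hker : Submodule.comap B.subtype (y • B) = LinearMap.ker f := by
    ext b
    have h1 : b ∈ LinearMap.ker f ↔ a⁻¹ ^ 2 • (b : V) ∈ E1 :=
      Submodule.Quotient.mk_eq_zero _
    rw [h1, Submodule.mem_comap, Submodule.mem_smul_pointwise_iff_exists, hE1]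
    constructor
    · rintro ⟨b', hb', h⟩
      change y • b' = (b : V) at h
      rw [← h, hsmul, smul_smul, show a⁻¹ ^ 2 * a = a⁻¹ by field_simp]
      exact Submodule.mem_sup_left (Submodule.smul_mem_pointwise_smul _ _ _ hb')
    · intro h
      obtain ⟨u, hu, c, hc, huc⟩ := Submodule.mem_sup.1 h
      obtain ⟨b', hb', rfl⟩ := (Submodule.mem_smul_pointwise_iff_exists _ _ _).1 hu
      have key : y ^ 2 • c = (b : V) - y • b' := by
        rw [eq_sub_of_add_eq' huc, hsmul2, hsmul, smul_sub, smul_smul, smul_smul,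
          show a ^ 2 * a⁻¹ ^ 2 = 1 by field_simp, show a ^ 2 * a⁻¹ = a by field_simp, one_smul]
      have hc0 := hBC c hc (key ▸ sub_mem b.2 (B.smul_mem y hb'))
      rw [hc0, smul_zero] at key
      exact ⟨b', hb', (sub_eq_zero.1 key.symm).symm⟩
  refine ⟨((Submodule.quotEquivOfEq _ _ hker).trans (f.quotKerEquivOfSurjective hf)).symm, ?_⟩
  intro w h
  rw [LinearEquiv.symm_apply_eq]
  change Submodule.Quotient.mk w = f ⟨_, h⟩
  refine congrArg Submodule.Quotient.mk (Subtype.ext ?_)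
  change (w : V) = a⁻¹ ^ 2 • y ^ 2 • (w : V)
  rw [hsmul2, smul_smul, show a⁻¹ ^ 2 * a ^ 2 = 1 by field_simp, one_smul]

/-- Split the last two summands off an indexed supremum of scaled submodules. -/
theorem iSup_fin_smul_eq_sup (n : ℕ) (A : ℕ → Submodule R V) (z : K) (j : ℕ) (hj : j ≤ 2)
    (hj1 : 1 ≤ j) :
    (⨆ k : Fin (n + 2 + 1), (z ^ min j (n + 2 - (k : ℕ))) • A k) =
      z ^ j • (⨆ k ∈ Finset.range (n + 1), A k) ⊔ (z • A (n + 1) ⊔ A (n + 2)) := by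
  apply le_antisymm
  · refine iSup_le fun k => ?_
    obtain hk | hk | hk : (k : ℕ) < n + 1 ∨ (k : ℕ) = n + 1 ∨ (k : ℕ) = n + 2 := by omega
    · rw [show min j (n + 2 - (k : ℕ)) = j by omega]
      refine le_sup_of_le_left (Submodule.map_mono ?_)
      exact le_iSup₂_of_le (k : ℕ) (Finset.mem_range.2 hk) le_rfl
    · rw [hk, show min j (n + 2 - (n + 1)) = 1 by omega, pow_one]
      exact le_sup_of_le_right le_sup_left
    · rw [hk, show min j (n + 2 - (n + 2)) = 0 by omega, pow_zero, one_smul]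
      exact le_sup_of_le_right le_sup_right
  · refine sup_le ?_ (sup_le ?_ ?_)
    · change Submodule.map _ _ ≤ _
      simp only [Submodule.map_iSup]
      refine iSup₂_le fun k hk => ?_
      have hk' := Finset.mem_range.1 hk
      refine le_iSup_of_le (⟨k, by omega⟩ : Fin (n + 2 + 1)) ?_
      simp only
      rw [show min j (n + 2 - k) = j by omega]
      exact le_rfl
    · refine le_iSup_of_le (⟨n + 1, by omega⟩ : Fin (n + 2 + 1)) ?_
      simp only
      rw [show min j (n + 2 - (n + 1)) = 1 by omega, pow_one]
    · refine le_iSup_of_le (⟨n + 2, by omega⟩ : Fin (n + 2 + 1)) ?_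
      simp only
      rw [show min j (n + 2 - (n + 2)) = 0 by omega, pow_zero, one_smul]

/-- The first summands of an independent family are disjoint from the last two. -/
theorem disjoint_iSup_range_sup (n : ℕ) (A : ℕ → Submodule R V)
    (hind : iSupIndep fun k : Fin (n + 2 + 1) => A k) :
    Disjoint (⨆ k ∈ Finset.range (n + 1), A k) (A (n + 1) ⊔ A (n + 2)) := by
  have h := hind.disjoint_biSup_biSup (s := {k : Fin (n + 2 + 1) | (k : ℕ) < n + 1})
    (t := {k : Fin (n + 2 + 1) | n + 1 ≤ (k : ℕ)})
    (Set.disjoint_left.2 fun k hk hk' => by simp only [Set.mem_ofPred_eq] at hk hk'; omega)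
  refine h.mono ?_ (sup_le ?_ ?_)
  · refine iSup₂_le fun k hk => ?_
    have hk' := Finset.mem_range.1 hk
    exact le_iSup₂_of_le (f := fun (k : Fin (n + 2 + 1)) _ => A k) ⟨k, by omega⟩ hk' le_rfl
  · exact le_iSup₂_of_le (f := fun (k : Fin (n + 2 + 1)) _ => A k) ⟨n + 1, by omega⟩
      (by simp) le_rfl
  · exact le_iSup₂_of_le (f := fun (k : Fin (n + 2 + 1)) _ => A k) ⟨n + 2, by omega⟩
      (by simp) le_rfl

end

/-- Local scalar form of the exact sequence
`0 → E₁ → E₂ → H² ⊗ O(D₂) → 0`: one has `E₁ ⊆ E₂`, the quotient `E₂/E₁` is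
annihilated by `y`, multiplication by `y²` induces an isomorphism
`E₂/E₁ ≅ (A₀ ⊕ ⋯ ⊕ A_{m−2})/y·(A₀ ⊕ ⋯ ⊕ A_{m−2})`, and `E₂/E₁` is a free
`R/(y)`-module of rank `rk A₀ + ⋯ + rk A_{m−2}`. -/
theorem echelon_second_modification_sequence
    {R K V : Type*} [CommRing R] [IsDomain R] [UniqueFactorizationMonoid R]
    [Field K] [Algebra R K] [IsFractionRing R K]
    [AddCommGroup V] [Module K V] [Module R V] [IsScalarTower R K V]
    (m : ℕ) (hm : 2 ≤ m)
    (t x y : R) (hx : x ≠ 0) (hy : y ≠ 0) (ht : t = x * y) (hxy : IsRelPrime x y)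
    (A : ℕ → Submodule R V)
    (hAfree : ∀ k ≤ m, Module.Free R ↥(A k))
    (hAfin : ∀ k ≤ m, Module.Finite R ↥(A k))
    (hindep : iSupIndep fun k : Fin (m + 1) => A k)
    (E : Submodule R V) (hE : E = ⨆ k : Fin (m + 1), A k)
    (Epow : ℕ → Submodule R V)
    (hEpow : ∀ i ≤ m, Epow i = ⨆ k : Fin (m + 1), (t ^ (i + (k : ℕ) - m)) • A k)
    (E1 E2 : Submodule R V)
    (hE1 : E1 = ⨆ k : Fin (m + 1), ((algebraMap R K y)⁻¹ ^ min 1 (m - (k : ℕ))) • A k)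
    (hE2 : E2 = ⨆ k : Fin (m + 1), ((algebraMap R K y)⁻¹ ^ min 2 (m - (k : ℕ))) • A k) :
    (E1 ≤ E2) ∧
    (∀ q : ↥E2 ⧸ Submodule.comap E2.subtype E1, y • q = 0) ∧
    (∃ e : (↥E2 ⧸ Submodule.comap E2.subtype E1) ≃ₗ[R]
        (↥(⨆ k ∈ Finset.range (m - 1), A k) ⧸
          Submodule.comap (⨆ k ∈ Finset.range (m - 1), A k).subtype
            (y • ⨆ k ∈ Finset.range (m - 1), A k)),
      ∀ (w : ↥E2) (h : (y ^ 2 : R) • (w : V) ∈ ⨆ k ∈ Finset.range (m - 1), A k),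
        e (Submodule.Quotient.mk w)
          = Submodule.Quotient.mk
              (⟨(y ^ 2 : R) • (w : V), h⟩ : ↥(⨆ k ∈ Finset.range (m - 1), A k))) ∧
    Nonempty ((↥E2 ⧸ Submodule.comap E2.subtype E1) ≃ₗ[R]
      (Fin (∑ k ∈ Finset.range (m - 1), Module.finrank R ↥(A k)) → R ⧸ Ideal.span {y})) := by
  obtain ⟨n, rfl⟩ := Nat.exists_eq_add_of_le' hm
  have ha : algebraMap R K y ≠ 0 := by
    rwa [Ne, IsFractionRing.to_map_eq_zero_iff]
  rw [iSup_fin_smul_eq_sup n A _ 1 one_le_two le_rfl, pow_one] at hE1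
  rw [iSup_fin_smul_eq_sup n A _ 2 le_rfl one_le_two] at hE2
  rw [show n + 2 - 1 = n + 1 by omega]
  have hdisj := disjoint_iSup_range_sup n A hindep
  obtain ⟨b⟩ := nonempty_basis_iSup_range (n + 1) A (fun k hk => hAfree k (by omega))
    (fun k hk => hAfin k (by omega))
    (hindep.comp (f := Fin.castLE (by omega : n + 1 ≤ n + 2 + 1)) (Fin.castLE_injective _))
  set B := ⨆ k ∈ Finset.range (n + 1), A k
  have hsmul (v : V) : y • v = algebraMap R K y • v := (algebraMap_smul K y v).symm
  have hBC : ∀ c ∈ (algebraMap R K y)⁻¹ • A (n + 1) ⊔ A (n + 2), y ^ 2 • c ∈ B → c = 0 := by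
    intro c hc hcB
    have hmem : y ^ 2 • c ∈ A (n + 1) ⊔ A (n + 2) := by
      obtain ⟨u, hu, v, hv, rfl⟩ := Submodule.mem_sup.1 hc
      obtain ⟨u, hu', rfl⟩ := (Submodule.mem_smul_pointwise_iff_exists _ _ _).1 hu
      rw [smul_add]
      refine add_mem (Submodule.mem_sup_left ?_)
        (Submodule.mem_sup_right (Submodule.smul_mem _ _ hv))
      rw [pow_two, mul_smul, hsmul ((algebraMap R K y)⁻¹ • u), smul_inv_smul₀ ha]
      exact Submodule.smul_mem _ _ hu'
    have h0 := Submodule.disjoint_def.1 hdisj _ hcB hmem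
    rw [← algebraMap_smul K, map_pow] at h0
    exact (smul_eq_zero.1 h0).resolve_left (pow_ne_zero 2 ha)
  obtain ⟨e, he⟩ := exists_quotient_equiv_of_sup y ha B _ hBC E1 E2 hE1 hE2
  obtain ⟨g⟩ := nonempty_quotient_smul_equiv_pi B y b
  refine ⟨?_, ?_, ⟨e, he⟩, ⟨e.trans g⟩⟩
  · rw [hE1, hE2]
    refine sup_le_sup_right ?_ _
    intro v hv
    obtain ⟨u, hu, rfl⟩ := (Submodule.mem_smul_pointwise_iff_exists _ _ _).1 hv
    refine (Submodule.mem_smul_pointwise_iff_exists _ _ _).2 ⟨y • u, B.smul_mem y hu, ?_⟩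
    rw [hsmul, pow_two, mul_smul, inv_smul_smul₀ ha]
  · intro q
    apply e.injective
    rw [map_smul, map_zero]
    obtain ⟨v, hv⟩ := Submodule.Quotient.mk_surjective _ (e q)
    rw [← hv, ← Submodule.Quotient.mk_smul, Submodule.Quotient.mk_eq_zero]
    exact Submodule.smul_mem_pointwise_smul _ _ _ v.2
end

section
/- For every 1 ≤ i ≤ m the quotient G^i := E^{i−1}/E^i is annihilated by t_i and is a free R/(t_i)-module of rank rk A_{m−i+1} + rk A_{m−i+2} + ⋯ + rk A_m. -/
open Pointwise

namespace Module.Basis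

/-- Membership in a sum of multiples of the summands of an internal direct sum, in terms of the
coordinates in a basis adapted to the decomposition. -/
theorem mem_iSup_smul_iff {R M κ : Type*} {ι : κ → Type*} [CommRing R] [AddCommGroup M]
    [Module R M] (b : Module.Basis (Σ k, ι k) R M) (A : κ → Submodule R M)
    (hA : ∀ x, b x ∈ A x.1) (hb : ∀ k, ∀ y ∈ A k, ∀ x : Σ k, ι k, x.1 ≠ k → b.repr y x = 0)
    (c : κ → R) (y : M) :
    y ∈ ⨆ k, c k • A k ↔ ∀ x, c x.1 ∣ b.repr y x := by
  constructor
  · intro hy x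
    induction hy using Submodule.iSup_induction' with
    | mem k z hz =>
      obtain ⟨w, hw, rfl⟩ := (Submodule.mem_smul_pointwise_iff_exists _ _ _).1 hz
      by_cases hx : x.1 = k
      · subst hx
        simp
      · simp [hb k w hw x hx]
    | zero => simp
    | add z w _ _ hz hw => simpa using dvd_add hz hw
  · intro h
    rw [← b.linearCombination_repr y, Finsupp.linearCombination_apply]
    refine Submodule.sum_mem _ fun x _ => ?_
    obtain ⟨r, hr⟩ := h x
    simp only [hr, mul_smul]
    exact Submodule.mem_iSup_of_mem x.1
      (Submodule.smul_mem_pointwise_smul _ _ _ ((A x.1).smul_mem r (hA x)))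

/-- A submodule cut out by divisibility of the coordinates has a basis of multiples of the
basis vectors. -/
theorem exists_basis_of_mem_iff_dvd {R M ι : Type*} [CommRing R] [IsDomain R] [AddCommGroup M]
    [Module R M] (b : Module.Basis ι R M) (c : ι → R) (hc : ∀ x, c x ≠ 0) (N : Submodule R M)
    (hN : ∀ y, y ∈ N ↔ ∀ x, c x ∣ b.repr y x) :
    ∃ B : Module.Basis ι R N, ∀ (y : N) x, b.repr (y : M) x = c x * B.repr y x := by
  let D : M →ₗ[R] M := b.constr R fun x => c x • b x
  have hD (y : M) (x : ι) : b.repr (D y) x = c x * b.repr y x := by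
    have h : (Finsupp.lapply x ∘ₗ b.repr.toLinearMap) ∘ₗ D
        = c x • (Finsupp.lapply x ∘ₗ b.repr.toLinearMap) := by
      refine b.ext fun z => ?_
      by_cases hz : z = x
      · subst hz
        simp [D]
      · simp [D, Finsupp.single_eq_of_ne (Ne.symm hz)]
    simpa using LinearMap.congr_fun h y
  have hDN (y : M) : D y ∈ N := (hN _).2 fun x => ⟨_, hD y x⟩
  have hbij : Function.Bijective (D.codRestrict N hDN) := by
    constructor
    · intro y z hyz
      have h : D y = D z := congrArg Subtype.val hyz
      refine b.repr.injective (Finsupp.ext fun x => mul_left_cancel₀ (hc x) ?_)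
      rw [← hD, ← hD, h]
    · rintro ⟨y, hy⟩
      choose r hr using (hN y).1 hy
      have hr0 (x : ι) (hx : r x ≠ 0) : x ∈ (b.repr y).support := by
        rw [Finsupp.mem_support_iff, hr]
        exact mul_ne_zero (hc x) hx
      refine ⟨b.repr.symm (Finsupp.onFinset _ r hr0), Subtype.ext ?_⟩
      refine b.repr.injective (Finsupp.ext fun x => ?_)
      simp [hD, hr]
  refine ⟨b.map (LinearEquiv.ofBijective _ hbij), fun y x => ?_⟩
  obtain ⟨z, rfl⟩ := (LinearEquiv.ofBijective _ hbij).surjective y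
  simp [hD]

/-- The quotient by the submodule of elements whose coordinates at indices satisfying `p` are
divisible by `a` is free over `R ⧸ (a)` on those indices. -/
theorem nonempty_quotient_equiv_of_mem_iff_dvd {R N ι : Type*} [CommRing R] [AddCommGroup N]
    [Module R N] [Finite ι] (B : Module.Basis ι R N) (p : ι → Prop) (a : R) (P : Submodule R N)
    (hP : ∀ y, y ∈ P ↔ ∀ x, p x → a ∣ B.repr y x) :
    Nonempty ((N ⧸ P) ≃ₗ[R] ({x // p x} → R ⧸ Ideal.span {a})) := by
  let f : N →ₗ[R] ({x // p x} → R ⧸ Ideal.span {a}) :=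
    LinearMap.pi fun x => (Ideal.span {a}).mkQ ∘ₗ B.coord x
  have hf : Function.Surjective f := by
    classical
    intro g
    choose r hr using fun x => (Ideal.span {a}).mkQ_surjective (g x)
    refine ⟨B.equivFun.symm fun x => if h : p x then r ⟨x, h⟩ else 0, ?_⟩
    ext x
    rw [← hr x]
    simp [f, x.2, -Basis.equivFun_symm_apply, ← Basis.equivFun_apply]
  have hker : P = LinearMap.ker f := by
    ext y
    rw [hP, LinearMap.mem_ker, funext_iff]
    simp [f, Ideal.Quotient.eq_zero_iff_mem, Ideal.mem_span_singleton]
  exact ⟨(Submodule.quotEquivOfEq _ _ hker).trans (f.quotKerEquivOfSurjective hf)⟩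

end Module.Basis

/-- Local form of the assertion that the graded piece
`Gⁱ = E^{i−1}/Eⁱ` of an echelon datum is annihilated by `t_i` and is a free
`R/(t_i)`-module of rank `rk A_{m−i+1} + ⋯ + rk A_m`. -/
theorem echelon_graded_piece_free
    {R M : Type*} [CommRing R] [IsDomain R]
    [AddCommGroup M] [Module R M] [Module.Free R M] [Module.Finite R M]
    (m : ℕ) (hm : 1 ≤ m)
    (t : ℕ → R) (ht : ∀ i ∈ Finset.Icc 1 m, t i ≠ 0)
    (A : ℕ → Submodule R M)
    (hAfree : ∀ k ≤ m, Module.Free R ↥(A k))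
    (hAfin : ∀ k ≤ m, Module.Finite R ↥(A k))
    (hindep : iSupIndep fun k : Fin (m + 1) => A k)
    (hsup : (⨆ k : Fin (m + 1), A k) = ⊤)
    (Epow : ℕ → Submodule R M)
    (hEpow : ∀ i ≤ m, Epow i
      = ⨆ k : Fin (m + 1), (∏ j ∈ Finset.Icc (m + 1 - (k : ℕ)) i, t j) • A k) :
    ∀ i, 1 ≤ i → i ≤ m →
      (∀ g : ↥(Epow (i - 1)) ⧸ Submodule.comap (Epow (i - 1)).subtype (Epow i),
        t i • g = 0) ∧
      Nonempty ((↥(Epow (i - 1)) ⧸ Submodule.comap (Epow (i - 1)).subtype (Epow i)) ≃ₗ[R]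
        (Fin (∑ k ∈ Finset.Icc (m - i + 1) m, Module.finrank R ↥(A k)) →
          R ⧸ Ideal.span {t i})) := by
  classical
  intro i hi him
  have hfree (k : Fin (m + 1)) : Module.Free R (A k) := hAfree k (by omega)
  have hfin (k : Fin (m + 1)) : Module.Finite R (A k) := hAfin k (by omega)
  have hint : DirectSum.IsInternal fun k : Fin (m + 1) => A k :=
    (DirectSum.isInternal_submodule_iff_iSupIndep_and_iSup_eq_top _).2 ⟨hindep, hsup⟩
  let b := hint.collectedBasis fun k => Module.finBasis R (A k)
  have hbA (x) : b x ∈ A x.1 := hint.collectedBasis_mem _ x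
  have hb (k : Fin (m + 1)) (y : M) (hy : y ∈ A k)
      (x : Σ k : Fin (m + 1), Fin (Module.finrank R (A k))) (hx : x.1 ≠ k) : b.repr y x = 0 :=
    hint.collectedBasis_repr_of_mem_ne _ hx.symm hy
  let c (n : ℕ) (k : Fin (m + 1)) : R := ∏ j ∈ Finset.Icc (m + 1 - (k : ℕ)) n, t j
  have hmem (n : ℕ) (hn : n ≤ m) (y : M) : y ∈ Epow n ↔ ∀ x, c n x.1 ∣ b.repr y x := by
    rw [hEpow n hn]
    exact b.mem_iSup_smul_iff (fun k : Fin (m + 1) => A k) hbA hb (c n) y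
  have hc (k : Fin (m + 1)) : c (i - 1) k ≠ 0 := by
    refine Finset.prod_ne_zero_iff.2 fun j hj => ht j ?_
    rw [Finset.mem_Icc] at hj ⊢
    omega
  have hstep (k : Fin (m + 1)) (hk : m - i + 1 ≤ (k : ℕ)) : c i k = c (i - 1) k * t i := by
    obtain ⟨n, rfl⟩ : ∃ n, i = n + 1 := ⟨i - 1, by omega⟩
    exact Finset.prod_Icc_succ_top (by omega) _
  have hone (k : Fin (m + 1)) (hk : ¬ m - i + 1 ≤ (k : ℕ)) : c i k = 1 := by
    simp only [c]
    rw [Finset.Icc_eq_empty (by omega), Finset.prod_empty]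
  obtain ⟨B, hB⟩ := b.exists_basis_of_mem_iff_dvd (fun x => c (i - 1) x.1) (fun x => hc x.1)
    (Epow (i - 1)) (hmem _ (by omega))
  obtain ⟨e⟩ := B.nonempty_quotient_equiv_of_mem_iff_dvd (fun x => m - i + 1 ≤ (x.1 : ℕ)) (t i)
    (Submodule.comap (Epow (i - 1)).subtype (Epow i)) (by
      intro y
      rw [Submodule.mem_comap, Submodule.subtype_apply, hmem i him]
      refine forall_congr' fun x => ?_
      by_cases hx : m - i + 1 ≤ (x.1 : ℕ)
      · rw [hstep _ hx, hB, mul_dvd_mul_iff_left (hc _)]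
        simp [hx]
      · simp [hone _ hx, hx])
  have hcard : Fintype.card {x : Σ k : Fin (m + 1), Fin (Module.finrank R (A k)) //
      m - i + 1 ≤ (x.1 : ℕ)} = ∑ k ∈ Finset.Icc (m - i + 1) m, Module.finrank R (A k) := by
    rw [Fintype.card_congr (Equiv.subtypeSigmaEquiv
      (fun k : Fin (m + 1) => Fin (Module.finrank R (A k))) fun k => m - i + 1 ≤ (k : ℕ)),
      Fintype.card_sigma]
    simp only [Fintype.card_fin]
    refine Finset.sum_bij (fun k _ => (k.1 : ℕ)) ?_ ?_ ?_ ?_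
    · intro k _
      exact Finset.mem_Icc.2 ⟨k.2, by omega⟩
    · intro k _ l _ h
      exact Subtype.ext (Fin.ext h)
    · intro k hk
      rw [Finset.mem_Icc] at hk
      exact ⟨⟨⟨k, by omega⟩, hk.1⟩, Finset.mem_univ _, rfl⟩
    · intro k _
      rfl
  refine ⟨fun g => e.injective ?_, ⟨e.trans (LinearEquiv.funCongrLeft R _
    (Fintype.equivFinOfCardEq hcard).symm)⟩⟩
  rw [map_smul, map_zero]
  ext x
  obtain ⟨r, hr⟩ := Ideal.Quotient.mk_surjective (e g x)
  rw [Pi.smul_apply, ← hr, Pi.zero_apply, Algebra.smul_def, Ideal.Quotient.algebraMap_eq,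
    ← map_mul, Ideal.Quotient.eq_zero_iff_mem]
  exact Ideal.mul_mem_right _ _ (Ideal.mem_span_singleton_self _)
end

section
/- For every 1 ≤ i ≤ m the natural R/(t_i)-linear map E^i/t_i·E^{i−1} → E^{i−1}/t_i·E^{i−1} induced by the inclusion E^i ⊆ E^{i−1} is injective, its image is a direct summand of the R/(t_i)-module E^{i−1}/t_i·E^{i−1}, and its cokernel is naturally isomorphic to E^{i−1}/E^i. That is, there is a split exact sequence 0 → H^i → E^{i−1} ⊗_R R/(t_i) → G^i → 0 of R/(t_i)-modules, where H^i = E^i/t_i·E^{i−1} and G^i = E^{i−1}/E^i. -/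
open Pointwise

/-- If `P = B ⊕ C` and `Q = B ⊕ t C` inside a module, then `Q / t P → P / t P` is injective, its
range has the image of `C` as a complement, and its cokernel is `P / Q`. -/
theorem exists_quotient_map_isCompl_range
    {R M : Type*} [CommRing R] [AddCommGroup M] [Module R M] (t : R)
    {B C P Q : Submodule R M} (hBC : Disjoint B C) (hP : P = B ⊔ C) (hQ : Q = B ⊔ t • C) :
    ∃ φ : (↥Q ⧸ Submodule.comap Q.subtype (t • P)) →ₗ[R]
        (↥P ⧸ Submodule.comap P.subtype (t • P)),
      (∀ (v : ↥Q) (h : (v : M) ∈ P),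
        φ (Submodule.Quotient.mk v) = Submodule.Quotient.mk (⟨(v : M), h⟩ : ↥P)) ∧
      Function.Injective φ ∧
      (∃ D, IsCompl (LinearMap.range φ) D) ∧
      ∃ e : ((↥P ⧸ Submodule.comap P.subtype (t • P)) ⧸ LinearMap.range φ) ≃ₗ[R]
          (↥P ⧸ Submodule.comap P.subtype Q),
        ∀ w : ↥P,
          e (Submodule.Quotient.mk (Submodule.Quotient.mk w)) = Submodule.Quotient.mk w := by
  have htC : t • C ≤ C := Submodule.smul_le_self_of_tower t C
  have hQP : Q ≤ P := by
    rw [hP, hQ]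
    exact sup_le_sup_left htC B
  have hBQ : B ≤ Q := hQ ▸ le_sup_left
  have hCP : C ≤ P := hP ▸ le_sup_right
  have htPQ : t • P ≤ Q := by
    rw [hP, hQ, Submodule.smul_sup']
    exact sup_le_sup_right (Submodule.smul_le_self_of_tower t B) _
  have hCQ : C ⊓ Q ≤ t • P := by
    rintro x ⟨hxC, hxQ⟩
    rw [hQ] at hxQ
    obtain ⟨b, hb, c, hc, rfl⟩ := Submodule.mem_sup.mp hxQ
    have hbC : b ∈ C := by simpa using C.sub_mem hxC (htC hc)
    rw [Submodule.disjoint_def.mp hBC b hb hbC, zero_add, hP, Submodule.smul_sup']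
    exact Submodule.mem_sup_right hc
  let φ : (↥Q ⧸ Submodule.comap Q.subtype (t • P)) →ₗ[R]
      (↥P ⧸ Submodule.comap P.subtype (t • P)) :=
    Submodule.mapQ _ _ (Submodule.inclusion hQP) fun _ hx => hx
  have hrange : LinearMap.range φ =
      (Submodule.comap P.subtype Q).map (Submodule.comap P.subtype (t • P)).mkQ := by
    rw [show LinearMap.range φ = _ from Submodule.range_mapQ _ _ _ _, Submodule.range_inclusion]
  refine ⟨φ, fun _ _ => rfl, ?_, ⟨(Submodule.comap P.subtype C).map (Submodule.mkQ _), ?_⟩, ?_⟩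
  · rw [← LinearMap.ker_eq_bot, LinearMap.ker_eq_bot']
    intro x
    induction x using Submodule.Quotient.induction_on with
    | H v =>
      intro hv
      have hv' : (v : M) ∈ t • P :=
        (Submodule.Quotient.mk_eq_zero (Submodule.comap P.subtype (t • P))).mp hv
      exact (Submodule.Quotient.mk_eq_zero _).mpr hv'
  · rw [hrange]
    constructor
    · rw [Submodule.disjoint_def]
      rintro _ ⟨q, hq, rfl⟩ ⟨c, hc, hcq⟩
      have hsub : (c : M) - q ∈ t • P :=
        (Submodule.Quotient.eq (Submodule.comap P.subtype (t • P))).mp hcq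
      have hcQ : (c : M) ∈ Q := by simpa using Q.add_mem (htPQ hsub) hq
      rw [← hcq]
      exact (Submodule.Quotient.mk_eq_zero _).mpr (hCQ ⟨hc, hcQ⟩)
    · rw [codisjoint_iff, ← Submodule.map_sup, eq_top_iff, ← Submodule.range_mkQ,
        LinearMap.range_eq_map]
      refine Submodule.map_mono ?_
      rintro ⟨x, hx⟩ -
      have hx' := hx
      rw [hP] at hx'
      obtain ⟨b, hb, c, hc, rfl⟩ := Submodule.mem_sup.mp hx'
      exact Submodule.mem_sup.mpr
        ⟨⟨b, hQP (hBQ hb)⟩, hBQ hb, ⟨c, hCP hc⟩, hc, rfl⟩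
  · exact ⟨(Submodule.quotEquivOfEq _ _ hrange).trans
      (Submodule.quotientQuotientEquivQuotient _ _ (Submodule.comap_mono htPQ)), fun _ => rfl⟩

/-- Local form of the locally split exact sequence
`0 → Hⁱ → E^{i−1} ⊗ O_{dδ_i} → Gⁱ → 0`: the natural map
`Eⁱ/t_i·E^{i−1} → E^{i−1}/t_i·E^{i−1}` is injective, its image is a direct summand,
and its cokernel is naturally isomorphic to `E^{i−1}/Eⁱ`. -/
theorem echelon_split_exact_sequence
    {R M : Type*} [CommRing R] [IsDomain R]
    [AddCommGroup M] [Module R M] [Module.Free R M] [Module.Finite R M]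
    (m : ℕ) (hm : 1 ≤ m)
    (t : ℕ → R) (ht : ∀ i ∈ Finset.Icc 1 m, t i ≠ 0)
    (A : ℕ → Submodule R M)
    (hAfree : ∀ k ≤ m, Module.Free R ↥(A k))
    (hAfin : ∀ k ≤ m, Module.Finite R ↥(A k))
    (hindep : iSupIndep fun k : Fin (m + 1) => A k)
    (hsup : (⨆ k : Fin (m + 1), A k) = ⊤)
    (Epow : ℕ → Submodule R M)
    (hEpow : ∀ i ≤ m, Epow i
      = ⨆ k : Fin (m + 1), (∏ j ∈ Finset.Icc (m + 1 - (k : ℕ)) i, t j) • A k) :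
    ∀ i, 1 ≤ i → i ≤ m →
      ∃ φ : (↥(Epow i) ⧸ Submodule.comap (Epow i).subtype (t i • Epow (i - 1))) →ₗ[R]
          (↥(Epow (i - 1)) ⧸ Submodule.comap (Epow (i - 1)).subtype (t i • Epow (i - 1))),
        (∀ (v : ↥(Epow i)) (h : (v : M) ∈ Epow (i - 1)),
          φ (Submodule.Quotient.mk v)
            = Submodule.Quotient.mk (⟨(v : M), h⟩ : ↥(Epow (i - 1)))) ∧
        Function.Injective φ ∧
        (∃ C, IsCompl (LinearMap.range φ) C) ∧
        ∃ e : ((↥(Epow (i - 1)) ⧸ Submodule.comap (Epow (i - 1)).subtype (t i • Epow (i - 1)))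
              ⧸ LinearMap.range φ) ≃ₗ[R]
            (↥(Epow (i - 1)) ⧸ Submodule.comap (Epow (i - 1)).subtype (Epow i)),
          ∀ w : ↥(Epow (i - 1)),
            e (Submodule.Quotient.mk (Submodule.Quotient.mk w)) = Submodule.Quotient.mk w := by
  intro i hi him
  set c : ℕ → ℕ → R := fun j k => ∏ l ∈ Finset.Icc (m + 1 - k) j, t l with hc
  have hlow : ∀ j ≤ i, ∀ k : Fin (m + 1), i < m + 1 - (k : ℕ) → c j k = 1 := fun j hj k hk => by
    simp only [hc]
    rw [Finset.Icc_eq_empty (by omega), Finset.prod_empty]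
  have hhigh : ∀ k : Fin (m + 1), ¬ i < m + 1 - (k : ℕ) → c i k = t i * c (i - 1) k :=
    fun k hk => by
      obtain ⟨j, rfl⟩ := Nat.exists_eq_add_of_le' hi
      simp only [hc, Nat.add_sub_cancel]
      rw [Finset.prod_Icc_succ_top (by omega), mul_comm]
  have hsplit : ∀ j ≤ i, Epow j =
      (⨆ (k : Fin (m + 1)) (_ : i < m + 1 - (k : ℕ)), A k) ⊔
        ⨆ (k : Fin (m + 1)) (_ : ¬ i < m + 1 - (k : ℕ)), c j k • A k := fun j hj => by
    rw [hEpow j (hj.trans him),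
      iSup_split _ fun k : Fin (m + 1) => i < m + 1 - (k : ℕ)]
    congr 1
    refine iSup_congr fun k => iSup_congr fun hk => ?_
    change c j k • A k = A k
    rw [hlow j hj k hk, one_smul]
  have hdisj : Disjoint (⨆ (k : Fin (m + 1)) (_ : i < m + 1 - (k : ℕ)), A k)
      (⨆ (k : Fin (m + 1)) (_ : ¬ i < m + 1 - (k : ℕ)), c (i - 1) k • A k) := by
    have hst : Disjoint {k : Fin (m + 1) | i < m + 1 - (k : ℕ)}
        {k : Fin (m + 1) | ¬ i < m + 1 - (k : ℕ)} :=
      Set.disjoint_left.mpr fun _ h h' => h' h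
    refine (hindep.disjoint_biSup_biSup hst).mono_right ?_
    exact iSup₂_mono fun k _ => Submodule.smul_le_self_of_tower (c (i - 1) k) (A k)
  refine exists_quotient_map_isCompl_range (t i) hdisj (hsplit (i - 1) (Nat.sub_le i 1)) ?_
  rw [hsplit i le_rfl]
  congr 1
  simp only [Submodule.smul_iSup']
  refine iSup_congr fun k => iSup_congr fun hk => ?_
  rw [hhigh k hk, mul_smul]
end

section
/- Let F be a finite free R-module, M a finitely generated R-module with y·M = 0 which is free as an R/(y)-module, and π : F → M a surjective R-linear map. Then ker π is a finitely generated projective R-module. If moreover R is an integral domain with fraction field K, then the inclusion ker π ⊆ F induces an isomorphism (ker π) ⊗_R K ≅ F ⊗_R K; in particular ker π has rank equal to the rank of F. -/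
universe u

section

open scoped TensorProduct

variable {R F M P : Type*} [CommRing R] [AddCommGroup F] [Module R F]
  [AddCommGroup M] [Module R M] [AddCommGroup P] [Module R P]

/-- If `M` is killed by `y` and is the cokernel of the injective multiplication by `y` on a
projective module `P`, the kernel of a surjection `π : F → M` from a projective module is a
retract of `F × P`. -/
theorem exists_retraction_ker_of_smul_cokernel [Module.Projective R F] [Module.Projective R P]
    (y : R) (hyM : ∀ v : M, y • v = 0) (π : F →ₗ[R] M) (hπ : Function.Surjective π)
    (p : P →ₗ[R] M) (hp : Function.Surjective p)
    (hy : Function.Injective (LinearMap.lsmul R P y))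
    (hker : LinearMap.ker p ≤ LinearMap.range (LinearMap.lsmul R P y)) :
    ∃ (i : LinearMap.ker π →ₗ[R] F × P) (s : F × P →ₗ[R] LinearMap.ker π),
      s ∘ₗ i = LinearMap.id := by
  obtain ⟨φ, hφ⟩ := Module.projective_lifting_property π p hπ
  obtain ⟨ψ, hψ⟩ := Module.projective_lifting_property p π hp
  replace hφ (v : P) : π (φ v) = p v := LinearMap.congr_fun hφ v
  replace hψ (f : F) : p (ψ f) = π f := LinearMap.congr_fun hψ f
  let e := LinearEquiv.ofInjective (LinearMap.lsmul R P y) hy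
  let q : LinearMap.ker π →ₗ[R] P :=
    e.symm.toLinearMap ∘ₗ (ψ ∘ₗ (LinearMap.ker π).subtype).codRestrict _ fun k =>
      hker (by simp [hψ])
  have hq (k : LinearMap.ker π) : y • q k = ψ k :=
    congrArg Subtype.val (e.apply_symm_apply _)
  let s : F × P →ₗ[R] LinearMap.ker π :=
    ((LinearMap.id - φ ∘ₗ ψ).coprod (y • φ)).codRestrict _ fun x => by
      simp [hφ, hψ, hyM]
  refine ⟨(LinearMap.ker π).subtype.prod q, s, LinearMap.ext fun k => Subtype.ext ?_⟩
  change (k : F) - φ (ψ k) + y • φ (q k) = k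
  rw [← map_smul, hq, sub_add_cancel]

/-- A submodule containing `y • F`, with `y` invertible in a flat algebra `K`, becomes all of
`F` after base change to `K`. -/
theorem baseChange_subtype_bijective_of_smul_mem {K : Type*} [CommRing K] [Algebra R K]
    [Module.Flat R K] (N : Submodule R F) (y : R) (hy : IsUnit (algebraMap R K y))
    (hN : ∀ f : F, y • f ∈ N) :
    Function.Bijective (LinearMap.baseChange K N.subtype) := by
  refine ⟨Module.Flat.lTensor_preserves_injective_linearMap _ N.injective_subtype, fun t => ?_⟩
  obtain ⟨u, hu⟩ := hy
  induction t using TensorProduct.induction_on with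
  | zero => exact ⟨0, map_zero _⟩
  | add a b ha hb =>
    obtain ⟨a, rfl⟩ := ha
    obtain ⟨b, rfl⟩ := hb
    exact ⟨a + b, map_add _ _ _⟩
  | tmul c f =>
    refine ⟨(↑u⁻¹ * c) ⊗ₜ[R] ⟨y • f, hN f⟩, ?_⟩
    rw [LinearMap.baseChange_tmul, Submodule.subtype_apply, ← TensorProduct.smul_tmul,
      Algebra.smul_def, ← hu, Units.mul_inv_cancel_left]

/-- A submodule containing `y • F`, for `y` acting injectively on `F`, has the rank of `F`. -/
theorem rank_eq_of_smul_mem [StrongRankCondition R] (N : Submodule R F) (y : R)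
    (hy : Function.Injective (LinearMap.lsmul R F y)) (hN : ∀ f : F, y • f ∈ N) :
    Module.rank R N = Module.rank R F :=
  (Submodule.rank_le N).antisymm <|
    LinearMap.rank_le_of_injective ((LinearMap.lsmul R F y).codRestrict N hN)
      fun _ _ h => hy (congrArg Subtype.val h)

end

/-- Local form of the statement that an elementary modification of a
vector bundle along a Cartier divisor is locally free of the same rank: if `π : F → M`
is a surjection from a finite free module onto a finitely generated module killed by a
non-zero-divisor `y` and free over `R/(y)`, then `ker π` is finitely generated
projective, and (when `R` is a domain with fraction field `K`) the inclusion
`ker π ⊆ F` becomes an isomorphism after tensoring with `K`, so `ker π` has the same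
rank as `F`. -/
theorem elementary_modification_kernel_projective
    {R F M : Type*} [CommRing R]
    [AddCommGroup F] [Module R F] [Module.Free R F] [Module.Finite R F]
    [AddCommGroup M] [Module R M] [Module.Finite R M]
    (y : R) (hy : y ∈ nonZeroDivisors R)
    (hyM : ∀ v : M, y • v = 0)
    (hMfree : ∃ n : ℕ, Nonempty (M ≃ₗ[R] (Fin n → R ⧸ Ideal.span {y})))
    (π : F →ₗ[R] M) (hπ : Function.Surjective π) :
    Module.Finite R ↥(LinearMap.ker π) ∧
    Module.Projective R ↥(LinearMap.ker π) ∧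
    ∀ (_ : IsDomain R) (K : Type u) [Field K] [Algebra R K] [IsFractionRing R K],
      Function.Bijective (LinearMap.baseChange K (LinearMap.ker π).subtype) ∧
      Module.rank R ↥(LinearMap.ker π) = Module.rank R F := by
  obtain ⟨n, ⟨e⟩⟩ := hMfree
  have hreg : IsSMulRegular R y := isSMulRegular_iff_right_eq_zero_of_smul.mpr hy.1
  let p : (Fin n → R) →ₗ[R] M :=
    e.symm.toLinearMap ∘ₗ (Ideal.span {y}).mkQ.compLeft (Fin n)
  have hp : Function.Surjective p :=
    e.symm.surjective.comp (Submodule.mkQ_surjective _).comp_left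
  have hinj : Function.Injective (LinearMap.lsmul R (Fin n → R) y) := fun a b h =>
    funext fun i => hreg (congrFun h i)
  have hker : LinearMap.ker p ≤ LinearMap.range (LinearMap.lsmul R (Fin n → R) y) := by
    intro v hv
    have hv' : (Ideal.span {y}).mkQ.compLeft (Fin n) v = 0 :=
      e.symm.map_eq_zero_iff.mp hv
    have hmem (i : Fin n) : ∃ c, v i = y * c := Ideal.mem_span_singleton.mp
      ((Submodule.Quotient.mk_eq_zero _).mp (congrFun hv' i))
    choose c hc using hmem
    exact ⟨c, funext fun i => (hc i).symm⟩
  obtain ⟨i, s, hsi⟩ := exists_retraction_ker_of_smul_cokernel y hyM π hπ p hp hinj hker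
  refine ⟨.of_surjective s fun k => ⟨i k, LinearMap.congr_fun hsi k⟩, .of_split i s hsi, ?_⟩
  intro _ K _ _ _
  have hmem (f : F) : y • f ∈ LinearMap.ker π := by simp [hyM]
  have hy0 : y ≠ 0 := nonZeroDivisors.ne_zero hy
  have : Module.Flat R K := IsLocalization.flat K (nonZeroDivisors R)
  exact ⟨baseChange_subtype_bijective_of_smul_mem _ y (IsLocalization.map_units K ⟨y, hy⟩) hmem,
    rank_eq_of_smul_mem _ y (smul_right_injective F hy0) hmem⟩
end
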